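/- arXiv:1307.0978 — 2 statements merged into one kernel-verified Lean document; each statement's English description precedes it below -/
import Mathlib

section
/- Let f ∈ 𝓒 and θ₀ ∈ ℝ, and let π be drawn from Q_{n,f,θ₀}. Then lim_{n→∞} Q_{n,f,θ₀}({π : t ↦ PL_n(π,t) has exactly one zero in ℝ}) = 1, and the root is √n-consistent: for every ε > 0 there exists M < ∞ such that limsup_{n→∞} Q_{n,f,θ₀}({π : there exists t with PL_n(π,t) = 0 and √n |t − θ₀| > M}) ≤ ε. -/
open MeasureTheory Filter Topology
open scoped ENNReal

noncomputable section

/-- The unit square `[0,1]²` in `ℝ × ℝ`. -/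
def unitSq : Set (ℝ × ℝ) := Set.Icc 0 1 ×ˢ Set.Icc 0 1

/-- Lebesgue measure restricted to `[0,1]`. -/
def unif01 : Measure ℝ := volume.restrict (Set.Icc 0 1)

/-- Lebesgue (uniform) measure on the unit square. -/
def usq : Measure (ℝ × ℝ) := unif01.prod unif01

/-- `𝓜`: Borel probability measures on `[0,1]²` with both marginals Lebesgue on `[0,1]`. -/
def MM : Set (Measure (ℝ × ℝ)) :=
  {μ | IsProbabilityMeasure μ ∧ μ.map Prod.fst = unif01 ∧ μ.map Prod.snd = unif01}

/-- The class `𝓒` of continuous functions on the unit square, not identically zero,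
with all row and column integrals vanishing. -/
def memC (f : ℝ × ℝ → ℝ) : Prop :=
  ContinuousOn f unitSq ∧ (∃ p ∈ unitSq, f p ≠ 0) ∧
    (∀ x ∈ Set.Icc (0 : ℝ) 1, (∫ z in (0 : ℝ)..1, f (x, z)) = 0) ∧
    (∀ y ∈ Set.Icc (0 : ℝ) 1, (∫ z in (0 : ℝ)..1, f (z, y)) = 0)

open scoped Classical in
/-- Kullback–Leibler divergence `D(μ‖ν)`, equal to `∫ log(dμ/dν) dμ` when `μ ≪ ν`
(and this integral exists), and `+∞` otherwise. -/
def KL (μ ν : Measure (ℝ × ℝ)) : ℝ≥0∞ :=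
  if μ ≪ ν ∧ Integrable (fun x => Real.log ((μ.rnDeriv ν x).toReal)) μ then
    ENNReal.ofReal (∫ x, Real.log ((μ.rnDeriv ν x).toReal) ∂μ)
  else ⊤

/-- The objective `θ μ[f] − D(μ‖u)`, as an extended real. -/
def objE (f : ℝ × ℝ → ℝ) (θ : ℝ) (μ : Measure (ℝ × ℝ)) : EReal :=
  ((θ * ∫ p, f p ∂μ : ℝ) : EReal) - (KL μ usq : EReal)

/-- `∑_{i=1}^n f(i/n, π(i)/n)`. -/
def permStat (f : ℝ × ℝ → ℝ) (n : ℕ) (π : Equiv.Perm (Fin n)) : ℝ :=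
  ∑ i : Fin n, f ((i.1 + 1 : ℝ) / n, ((π i).1 + 1 : ℝ) / n)

/-- The log normalizing constant `Z_n(f,θ)`. -/
def Zn (f : ℝ × ℝ → ℝ) (θ : ℝ) (n : ℕ) : ℝ :=
  Real.log (∑ π : Equiv.Perm (Fin n), Real.exp (θ * permStat f n π))

open scoped Classical in
/-- The probability that a sample from `Q_{n,f,θ}` satisfies `p`. -/
def Qprob (f : ℝ × ℝ → ℝ) (θ : ℝ) (n : ℕ) (p : Equiv.Perm (Fin n) → Prop) : ℝ :=
  ∑ π : Equiv.Perm (Fin n), if p π then Real.exp (θ * permStat f n π - Zn f θ n) else 0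

/-- `y_π(i,j) = f(i/n,π(i)/n) + f(j/n,π(j)/n) − f(i/n,π(j)/n) − f(j/n,π(i)/n)`. -/
def ypi (f : ℝ × ℝ → ℝ) (n : ℕ) (π : Equiv.Perm (Fin n)) (i j : Fin n) : ℝ :=
  f ((i.1 + 1 : ℝ) / n, ((π i).1 + 1 : ℝ) / n)
    + f ((j.1 + 1 : ℝ) / n, ((π j).1 + 1 : ℝ) / n)
    - f ((i.1 + 1 : ℝ) / n, ((π j).1 + 1 : ℝ) / n)
    - f ((j.1 + 1 : ℝ) / n, ((π i).1 + 1 : ℝ) / n)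

open scoped Classical in
/-- The pseudo-likelihood estimating function
`PL_n(π,t) = ∑_{i<j} y_π(i,j) / (1 + exp(t y_π(i,j)))`. -/
def PLn (f : ℝ × ℝ → ℝ) (n : ℕ) (π : Equiv.Perm (Fin n)) (t : ℝ) : ℝ :=
  ∑ p ∈ Finset.univ.filter (fun p : Fin n × Fin n => p.1 < p.2),
    ypi f n π p.1 p.2 / (1 + Real.exp (t * ypi f n π p.1 p.2))

/-- The second-moment bound behind the method of exchangeable pairs: if every `h i` is
antisymmetric under the translation `· * τ i` with respect to the weights `w`, then `∑ i, h i` has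
a second moment controlled by its increments along these translations. -/
lemma sum_weight_mul_sq_le {G ι : Type*} [Group G] [Fintype G] [Fintype ι]
    (w : G → ℝ) (hw : ∀ π, 0 ≤ w π) (hw1 : ∑ π, w π = 1) (h : ι → G → ℝ) (τ : ι → G)
    (hanti : ∀ i π, w (π * τ i) * h i (π * τ i) = -(w π * h i π)) {B L : ℝ}
    (hB : ∀ i π, |h i π| ≤ B)
    (hL : ∀ i π, |∑ k, h k π - ∑ k, h k (π * τ i)| ≤ L) :
    ∑ π, w π * (∑ k, h k π) ^ 2 ≤ Fintype.card ι * (B * L) := by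
  have key : ∀ i, ∑ π, w π * h i π * ∑ k, h k π ≤ B * L := by
    intro i
    have h1 : ∑ π, w π * h i π * ∑ k, h k π
        = -∑ π, w π * h i π * ∑ k, h k (π * τ i) := by
      rw [← Equiv.sum_comp (Equiv.mulRight (τ i)), ← Finset.sum_neg_distrib]
      refine Finset.sum_congr rfl fun π _ => ?_
      simp only [Equiv.coe_mulRight]
      rw [hanti, neg_mul]
    have h2 : ∑ π, w π * h i π * (∑ k, h k π - ∑ k, h k (π * τ i)) ≤ B * L := by
      calc _ ≤ ∑ π, w π * (B * L) := by
            refine Finset.sum_le_sum fun π _ => ?_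
            rw [mul_assoc]
            refine mul_le_mul_of_nonneg_left ((le_abs_self _).trans ?_) (hw π)
            rw [abs_mul]
            exact mul_le_mul (hB i π) (hL i π) (abs_nonneg _) ((abs_nonneg _).trans (hB i π))
        _ = B * L := by rw [← Finset.sum_mul, hw1, one_mul]
    have h3 : 0 ≤ B * L :=
      mul_nonneg ((abs_nonneg _).trans (hB i 1)) ((abs_nonneg _).trans (hL i 1))
    simp only [mul_sub, Finset.sum_sub_distrib] at h2
    linarith
  calc ∑ π, w π * (∑ k, h k π) ^ 2 = ∑ i, ∑ π, w π * h i π * ∑ k, h k π := by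
        rw [Finset.sum_comm]
        refine Finset.sum_congr rfl fun π _ => ?_
        rw [← Finset.sum_mul, ← Finset.mul_sum, sq, mul_assoc]
    _ ≤ ∑ _i : ι, B * L := Finset.sum_le_sum fun i _ => key i
    _ = _ := by simp

open scoped Classical in
/-- Chebyshev's inequality for a finite weighted sum. -/
lemma sum_ite_lt_abs_le {Ω : Type*} [Fintype Ω] (w : Ω → ℝ) (hw : ∀ π, 0 ≤ w π) (H : Ω → ℝ)
    {a V : ℝ} (ha : 0 < a) (hV : ∑ π, w π * H π ^ 2 ≤ V) :
    ∑ π, (if a < |H π| then w π else 0) ≤ V / a ^ 2 := by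
  rw [le_div_iff₀ (by positivity), Finset.sum_mul]
  refine (Finset.sum_le_sum fun π _ => ?_).trans hV
  split_ifs with h
  · refine mul_le_mul_of_nonneg_left ?_ (hw π)
    rw [← sq_abs (H π)]
    gcongr
  · rw [zero_mul]
    exact mul_nonneg (hw π) (sq_nonneg _)

lemma exp_neg_div_one_add_exp_neg (x : ℝ) :
    Real.exp (-x) / (1 + Real.exp (-x)) = 1 / (1 + Real.exp x) := by
  have := Real.exp_pos x
  rw [Real.exp_neg]
  field_simp
  ring

/-- For a matrix with small row and column sums, subtracting a matrix of the form `u i + v a - W`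
cannot substantially decrease the sum of squares. -/
lemma sum_sq_sub_le_sum_add_sub_sub_sq {α : Type*} [Fintype α]
    {A : α → α → ℝ} {C r : ℝ} (hC : 0 ≤ C)
    (hrow : ∀ i, |∑ a, A i a| ≤ r) (hcol : ∀ a, |∑ i, A i a| ≤ r) (u v : α → ℝ) {W : ℝ}
    (hu : ∀ i, |u i| ≤ C) (hv : ∀ a, |v a| ≤ C) (hW : |W| ≤ C) :
    ∑ i, ∑ a, A i a ^ 2 - 6 * (Fintype.card α * (C * r))
      ≤ ∑ i, ∑ a, (A i a + W - u i - v a) ^ 2 := by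
  have bound : ∀ (x : α → ℝ) (s : α → ℝ), (∀ i, |x i| ≤ C) → (∀ i, |s i| ≤ r) →
      |∑ i, x i * s i| ≤ Fintype.card α * (C * r) := by
    intro x s hx hs
    refine (Finset.abs_sum_le_sum_abs _ _).trans ?_
    calc ∑ i, |x i * s i| ≤ ∑ _i : α, C * r := by
          refine Finset.sum_le_sum fun i _ => ?_
          rw [abs_mul]
          exact mul_le_mul (hx i) (hs i) (abs_nonneg _) hC
      _ = _ := by simp
  have b1 := (abs_le.1 (bound (fun _ => W) _ (fun _ => hW) hrow)).1
  have b2 := (abs_le.1 (bound u _ hu hrow)).2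
  have b3 := (abs_le.1 (bound v _ hv hcol)).2
  have hpt : ∑ i, ∑ a, (A i a ^ 2 + 2 * (W * A i a) - 2 * (u i * A i a) - 2 * (v a * A i a))
      ≤ ∑ i, ∑ a, (A i a + W - u i - v a) ^ 2 :=
    Finset.sum_le_sum fun i _ => Finset.sum_le_sum fun a _ => by
      nlinarith [sq_nonneg (W - u i - v a)]
  have hcomm : ∑ i, ∑ a, v a * A i a = ∑ a, v a * ∑ i, A i a := by
    rw [Finset.sum_comm]
    simp only [Finset.mul_sum]
  simp only [Finset.sum_sub_distrib, Finset.sum_add_distrib, ← Finset.mul_sum] at hpt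
  simp only [← Finset.mul_sum] at hcomm b1
  linarith

section Gibbs

variable {α : Type*}

/-- The decrease of `∑ i, A i (π i)` when the values of `π` at `i` and `j` are exchanged. -/
def swapDiff (A : α → α → ℝ) (π : Equiv.Perm α) (i j : α) : ℝ :=
  A i (π i) + A j (π j) - A i (π j) - A j (π i)

lemma swapDiff_comm (A : α → α → ℝ) (π : Equiv.Perm α) (i j : α) :
    swapDiff A π i j = swapDiff A π j i := by
  simp only [swapDiff]; ring

lemma swapDiff_self (A : α → α → ℝ) (π : Equiv.Perm α) (i : α) : swapDiff A π i i = 0 := by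
  simp only [swapDiff]; ring

lemma swapDiff_congr (A : α → α → ℝ) {π σ : Equiv.Perm α} {i j : α} (hi : π i = σ i)
    (hj : π j = σ j) : swapDiff A π i j = swapDiff A σ i j := by
  simp only [swapDiff, hi, hj]

lemma abs_swapDiff_le {A : α → α → ℝ} {C : ℝ} (hA : ∀ i a, |A i a| ≤ C) (π : Equiv.Perm α)
    (i j : α) : |swapDiff A π i j| ≤ 4 * C := by
  have h1 := abs_le.1 (hA i (π i))
  have h2 := abs_le.1 (hA j (π j))
  have h3 := abs_le.1 (hA i (π j))
  have h4 := abs_le.1 (hA j (π i))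
  rw [swapDiff, abs_le]
  constructor <;> linarith [h1.1, h1.2, h2.1, h2.2, h3.1, h3.2, h4.1, h4.2]

variable [DecidableEq α]

lemma swapDiff_mul_swap (A : α → α → ℝ) (π : Equiv.Perm α) (i j : α) :
    swapDiff A (π * Equiv.swap i j) i j = -swapDiff A π i j := by
  simp only [swapDiff, Equiv.Perm.mul_apply, Equiv.swap_apply_left, Equiv.swap_apply_right]
  ring

lemma mul_swap_apply_of_ne (π : Equiv.Perm α) {a b i : α} (ha : i ≠ a) (hb : i ≠ b) :
    (π * Equiv.swap a b) i = π i := by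
  rw [Equiv.Perm.mul_apply, Equiv.swap_apply_of_ne_of_ne ha hb]

variable [Fintype α]

lemma sum_mul_swap_apply (A : α → α → ℝ) (π : Equiv.Perm α) (i j : α) :
    ∑ k, A k ((π * Equiv.swap i j) k) = ∑ k, A k (π k) - swapDiff A π i j := by
  rcases eq_or_ne i j with rfl | hij
  · simp [swapDiff_self]
  have h : ∑ k, (A k (π k) - A k ((π * Equiv.swap i j) k)) = swapDiff A π i j := by
    rw [← Finset.sum_subset (Finset.subset_univ {i, j}), Finset.sum_pair hij]
    · simp only [swapDiff, Equiv.Perm.mul_apply, Equiv.swap_apply_left, Equiv.swap_apply_right]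
      ring
    · intro k _ hk
      simp only [Finset.mem_insert, Finset.mem_singleton, not_or] at hk
      rw [mul_swap_apply_of_ne π hk.1 hk.2, sub_self]
  rw [Finset.sum_sub_distrib] at h
  linarith

/-- Probability weights on permutations whose ratios under transpositions are those of the
exponential family with sufficient statistic `∑ i, A i (π i)`. -/
structure IsGibbsWeight (A : α → α → ℝ) (θ : ℝ) (w : Equiv.Perm α → ℝ) : Prop where
  nonneg : ∀ π, 0 ≤ w π
  sum_eq_one : ∑ π, w π = 1
  mul_swap : ∀ π i j, w (π * Equiv.swap i j) = w π * Real.exp (-(θ * swapDiff A π i j))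

/-- The weighted mean square of the pairwise score statistic is at most of order `n³`. -/
lemma IsGibbsWeight.sum_mul_score_sq_le {A : α → α → ℝ} {θ : ℝ} {w : Equiv.Perm α → ℝ}
    (hw : IsGibbsWeight A θ w) {C : ℝ} (hA : ∀ i a, |A i a| ≤ C) :
    ∑ π, w π * (∑ p : α × α, swapDiff A π p.1 p.2
      / (1 + Real.exp (θ * swapDiff A π p.1 p.2))) ^ 2
      ≤ 128 * C ^ 2 * (Fintype.card α : ℝ) ^ 3 := by
  set h : α × α → Equiv.Perm α → ℝ := fun p π =>
    swapDiff A π p.1 p.2 / (1 + Real.exp (θ * swapDiff A π p.1 p.2)) with hh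
  have hB : ∀ p π, |h p π| ≤ 4 * C := by
    intro p π
    refine le_trans ?_ (abs_swapDiff_le hA π p.1 p.2)
    have := Real.exp_pos (θ * swapDiff A π p.1 p.2)
    rw [hh, abs_div, abs_of_pos (show 0 < 1 + Real.exp (θ * swapDiff A π p.1 p.2) by linarith)]
    exact div_le_self (abs_nonneg _) (by linarith)
  have hanti : ∀ (p : α × α) π, w (π * Equiv.swap p.1 p.2) * h p (π * Equiv.swap p.1 p.2)
      = -(w π * h p π) := by
    intro p π
    have := exp_neg_div_one_add_exp_neg (θ * swapDiff A π p.1 p.2)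
    simp only [hh, swapDiff_mul_swap, hw.mul_swap, mul_neg]
    rw [neg_div, div_eq_mul_one_div (swapDiff A π p.1 p.2) (1 + Real.exp (θ * _)), ← this]
    ring
  have hL : ∀ (p : α × α) π, |∑ q, h q π - ∑ q, h q (π * Equiv.swap p.1 p.2)|
      ≤ 32 * C * Fintype.card α := by
    rintro ⟨a, b⟩ π
    rw [← Finset.sum_sub_distrib]
    set e : α → ℝ := fun x => (if x = a then 1 else 0) + (if x = b then 1 else 0) with he
    have hsum : ∑ x, e x = 2 := by simp [he, Finset.sum_add_distrib]; norm_num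
    have hterm : ∀ q : α × α, |h q π - h q (π * Equiv.swap a b)|
        ≤ 8 * C * (e q.1 + e q.2) := by
      rintro ⟨i, j⟩
      have h0 : 0 ≤ C := (abs_nonneg _).trans (hA i i)
      have h1 : |h (i, j) π - h (i, j) (π * Equiv.swap a b)| ≤ 8 * C :=
        (abs_sub _ _).trans (by linarith [hB (i, j) π, hB (i, j) (π * Equiv.swap a b)])
      by_cases hq : i ≠ a ∧ i ≠ b ∧ j ≠ a ∧ j ≠ b
      · obtain ⟨h1, h2, h3, h4⟩ := hq
        have : swapDiff A (π * Equiv.swap a b) i j = swapDiff A π i j :=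
          swapDiff_congr A (mul_swap_apply_of_ne π h1 h2) (mul_swap_apply_of_ne π h3 h4)
        simp [hh, he, this, h1, h2, h3, h4]
      · refine h1.trans (le_mul_of_one_le_right (by linarith) ?_)
        simp only [he]
        split_ifs <;> first | (norm_num; done) | (exfalso; tauto)
    refine (Finset.abs_sum_le_sum_abs _ _).trans
      ((Finset.sum_le_sum fun q _ => hterm q).trans_eq ?_)
    rw [← Finset.mul_sum]
    simp only [Fintype.sum_prod_type, Finset.sum_add_distrib, Finset.sum_const,
      Finset.card_univ, nsmul_eq_mul, ← Finset.mul_sum, hsum]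
    ring
  have := sum_weight_mul_sq_le w hw.nonneg hw.sum_eq_one h (fun p => Equiv.swap p.1 p.2) hanti hB hL
  refine this.trans_eq ?_
  rw [Fintype.card_prod]
  push_cast
  ring

/-- The weighted mean square of the fluctuation of `∑ i j, (swapDiff A π i j)²` under
resampling along transpositions is at most of order `n⁵`. -/
lemma IsGibbsWeight.sum_mul_fluctuation_sq_le {A : α → α → ℝ} {θ : ℝ} {w : Equiv.Perm α → ℝ}
    (hw : IsGibbsWeight A θ w) {C : ℝ} (hA : ∀ i a, |A i a| ≤ C) :
    ∑ π, w π * (∑ p : α × α × α,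
      (swapDiff A π p.1 p.2.2 ^ 2 - swapDiff A (π * Equiv.swap p.1 p.2.1) p.1 p.2.2 ^ 2)
        / (1 + Real.exp (θ * swapDiff A π p.1 p.2.1))) ^ 2
      ≤ 3072 * C ^ 4 * (Fintype.card α : ℝ) ^ 5 := by
  set h : α × α × α → Equiv.Perm α → ℝ := fun p π =>
    (swapDiff A π p.1 p.2.2 ^ 2 - swapDiff A (π * Equiv.swap p.1 p.2.1) p.1 p.2.2 ^ 2)
        / (1 + Real.exp (θ * swapDiff A π p.1 p.2.1)) with hh
  have hsq : ∀ π i j, swapDiff A π i j ^ 2 ≤ 16 * C ^ 2 := by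
    intro π i j
    have h1 := abs_swapDiff_le hA π i j
    calc swapDiff A π i j ^ 2 = |swapDiff A π i j| ^ 2 := (sq_abs _).symm
      _ ≤ (4 * C) ^ 2 := by gcongr
      _ = _ := by ring
  have hB : ∀ p π, |h p π| ≤ 16 * C ^ 2 := by
    rintro ⟨i, k, j⟩ π
    have := Real.exp_pos (θ * swapDiff A π i k)
    have h1 := hsq π i j
    have h2 := hsq (π * Equiv.swap i k) i j
    have h3 := sq_nonneg (swapDiff A π i j)
    have h4 := sq_nonneg (swapDiff A (π * Equiv.swap i k) i j)
    simp only [hh]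
    rw [abs_div, abs_of_pos (show 0 < 1 + Real.exp (θ * swapDiff A π i k) by linarith)]
    refine (div_le_self (abs_nonneg _) (by linarith)).trans ?_
    rw [abs_le]
    constructor <;> linarith
  have hanti : ∀ (p : α × α × α) π,
      w (π * Equiv.swap p.1 p.2.1) * h p (π * Equiv.swap p.1 p.2.1) = -(w π * h p π) := by
    rintro ⟨i, k, j⟩ π
    have := exp_neg_div_one_add_exp_neg (θ * swapDiff A π i k)
    simp only [hh, swapDiff_mul_swap, hw.mul_swap, mul_neg, mul_assoc, Equiv.swap_mul_self,
      mul_one]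
    rw [div_eq_mul_one_div _ (1 + Real.exp (θ * swapDiff A π i k)), ← this]
    ring
  have hL : ∀ (p : α × α × α) π, |∑ q, h q π - ∑ q, h q (π * Equiv.swap p.1 p.2.1)|
      ≤ 192 * C ^ 2 * (Fintype.card α : ℝ) ^ 2 := by
    rintro ⟨a, b, c⟩ π
    rw [← Finset.sum_sub_distrib]
    set e : α → ℝ := fun x => (if x = a then 1 else 0) + (if x = b then 1 else 0) with he
    have hsum : ∑ x, e x = 2 := by simp [he, Finset.sum_add_distrib]; norm_num
    have hterm : ∀ q : α × α × α, |h q π - h q (π * Equiv.swap a b)|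
        ≤ 32 * C ^ 2 * (e q.1 + e q.2.1 + e q.2.2) := by
      rintro ⟨i, k, j⟩
      have h1 : |h (i, k, j) π - h (i, k, j) (π * Equiv.swap a b)| ≤ 32 * C ^ 2 :=
        (abs_sub _ _).trans (by linarith [hB (i, k, j) π, hB (i, k, j) (π * Equiv.swap a b)])
      by_cases hq : (i ≠ a ∧ i ≠ b) ∧ (k ≠ a ∧ k ≠ b) ∧ (j ≠ a ∧ j ≠ b)
      · obtain ⟨hi, hk, hj⟩ := hq
        have hi' := mul_swap_apply_of_ne π hi.1 hi.2
        have hk' := mul_swap_apply_of_ne π hk.1 hk.2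
        have hj' := mul_swap_apply_of_ne π hj.1 hj.2
        have e1 : swapDiff A (π * Equiv.swap a b) i j = swapDiff A π i j :=
          swapDiff_congr A hi' hj'
        have e2 : swapDiff A (π * Equiv.swap a b) i k = swapDiff A π i k :=
          swapDiff_congr A hi' hk'
        have e3 : swapDiff A (π * Equiv.swap a b * Equiv.swap i k) i j
            = swapDiff A (π * Equiv.swap i k) i j := by
          refine swapDiff_congr A ?_ ?_
          · rw [Equiv.Perm.mul_apply, Equiv.swap_apply_left, hk', Equiv.Perm.mul_apply,
              Equiv.swap_apply_left]
          · rw [Equiv.Perm.mul_apply, Equiv.Perm.mul_apply π (Equiv.swap i k),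
              Equiv.swap_apply_def i k]
            split_ifs
            exacts [hk', hi', hj']
        simp [hh, he, e1, e2, e3, hi.1, hi.2, hj.1, hj.2, hk.1, hk.2]
      · refine h1.trans (le_mul_of_one_le_right (by positivity) ?_)
        simp only [he]
        split_ifs <;> first | (norm_num; done) | (exfalso; tauto)
    refine (Finset.abs_sum_le_sum_abs _ _).trans
      ((Finset.sum_le_sum fun q _ => hterm q).trans_eq ?_)
    rw [← Finset.mul_sum]
    simp only [Fintype.sum_prod_type, Finset.sum_add_distrib, Finset.sum_const,
      Finset.card_univ, nsmul_eq_mul, ← Finset.mul_sum, hsum, Fintype.card_prod, Nat.cast_mul]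
    ring
  have := sum_weight_mul_sq_le w hw.nonneg hw.sum_eq_one h (fun p => Equiv.swap p.1 p.2.1) hanti hB hL
  refine this.trans_eq ?_
  rw [Fintype.card_prod, Fintype.card_prod]
  push_cast
  ring

lemma card_mul_le_sum_swapDiff_mul_swap_sq {A : α → α → ℝ} {C r : ℝ} (hC : 0 ≤ C)
    (hA : ∀ i a, |A i a| ≤ C) (hrow : ∀ i, |∑ a, A i a| ≤ r) (hcol : ∀ a, |∑ i, A i a| ≤ r)
    (π : Equiv.Perm α) :
    Fintype.card α * (∑ i, ∑ a, A i a ^ 2 - 6 * (Fintype.card α * (C * r)))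
      ≤ ∑ p : α × α × α, swapDiff A (π * Equiv.swap p.1 p.2.1) p.1 p.2.2 ^ 2 := by
  have hpt : ∀ i k j, (A i (π k) + A j (π j) - A i (π j) - A j (π k)) ^ 2
      ≤ swapDiff A (π * Equiv.swap i k) i j ^ 2 := by
    intro i k j
    have hi : (π * Equiv.swap i k) i = π k := by simp
    by_cases hji : j = i
    · subst hji
      rw [show A j (π k) + A j (π j) - A j (π j) - A j (π k) = 0 by ring,
        zero_pow two_ne_zero]
      exact sq_nonneg _
    by_cases hjk : j = k
    · subst hjk
      rw [show A i (π j) + A j (π j) - A i (π j) - A j (π j) = 0 by ring,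
        zero_pow two_ne_zero]
      exact sq_nonneg _
    · rw [swapDiff, hi, mul_swap_apply_of_ne π hji hjk]
  calc _ = ∑ _j : α, (∑ i, ∑ a, A i a ^ 2 - 6 * (Fintype.card α * (C * r))) := by
        rw [Finset.sum_const, Finset.card_univ, nsmul_eq_mul]
    _ ≤ ∑ j, ∑ i, ∑ a, (A i a + A j (π j) - A i (π j) - A j a) ^ 2 :=
        Finset.sum_le_sum fun j _ => sum_sq_sub_le_sum_add_sub_sub_sq hC hrow hcol
          (fun i => A i (π j)) (fun a => A j a) (fun _ => hA _ _) (fun _ => hA _ _) (hA _ _)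
    _ = ∑ j, ∑ i, ∑ k, (A i (π k) + A j (π j) - A i (π j) - A j (π k)) ^ 2 := by
        refine Finset.sum_congr rfl fun j _ => Finset.sum_congr rfl fun i _ => ?_
        exact (Equiv.sum_comp π fun a => (A i a + A j (π j) - A i (π j) - A j a) ^ 2).symm
    _ ≤ ∑ j, ∑ i, ∑ k, swapDiff A (π * Equiv.swap i k) i j ^ 2 :=
        Finset.sum_le_sum fun j _ => Finset.sum_le_sum fun i _ => Finset.sum_le_sum fun k _ =>
          hpt i k j
    _ = _ := by
        rw [Fintype.sum_prod_type, Finset.sum_comm]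
        refine Finset.sum_congr rfl fun i _ => ?_
        rw [Fintype.sum_prod_type, Finset.sum_comm]

/-- A deterministic lower bound for `∑ i j, (swapDiff A π i j)²` when the fluctuation under
resampling is small. -/
lemma le_card_mul_sum_swapDiff_sq {A : α → α → ℝ} {C r θ R h : ℝ} (hC : 0 ≤ C)
    (hA : ∀ i a, |A i a| ≤ C) (hrow : ∀ i, |∑ a, A i a| ≤ r) (hcol : ∀ a, |∑ i, A i a| ≤ r)
    (hR : |θ| * (4 * C) ≤ R) (π : Equiv.Perm α)
    (hH : |∑ p : α × α × α,
      (swapDiff A π p.1 p.2.2 ^ 2 - swapDiff A (π * Equiv.swap p.1 p.2.1) p.1 p.2.2 ^ 2)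
        / (1 + Real.exp (θ * swapDiff A π p.1 p.2.1))| ≤ h) :
    Fintype.card α * (∑ i, ∑ a, A i a ^ 2 - 6 * (Fintype.card α * (C * r)))
        / (1 + Real.exp R) - h
      ≤ Fintype.card α * ∑ p : α × α, swapDiff A π p.1 p.2 ^ 2 := by
  have hpt : ∀ p : α × α × α,
      swapDiff A (π * Equiv.swap p.1 p.2.1) p.1 p.2.2 ^ 2 / (1 + Real.exp R)
        - swapDiff A π p.1 p.2.2 ^ 2
      ≤ -((swapDiff A π p.1 p.2.2 ^ 2 - swapDiff A (π * Equiv.swap p.1 p.2.1) p.1 p.2.2 ^ 2)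
        / (1 + Real.exp (θ * swapDiff A π p.1 p.2.1))) := by
    intro p
    have h1 : θ * swapDiff A π p.1 p.2.1 ≤ R := by
      refine (le_abs_self _).trans (le_trans ?_ hR)
      rw [abs_mul]
      exact mul_le_mul_of_nonneg_left (abs_swapDiff_le hA π _ _) (abs_nonneg _)
    have h2 := Real.exp_pos (θ * swapDiff A π p.1 p.2.1)
    have h3 : swapDiff A (π * Equiv.swap p.1 p.2.1) p.1 p.2.2 ^ 2 / (1 + Real.exp R)
        ≤ swapDiff A (π * Equiv.swap p.1 p.2.1) p.1 p.2.2 ^ 2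
          / (1 + Real.exp (θ * swapDiff A π p.1 p.2.1)) := by gcongr
    have h4 : swapDiff A π p.1 p.2.2 ^ 2 / (1 + Real.exp (θ * swapDiff A π p.1 p.2.1))
        ≤ swapDiff A π p.1 p.2.2 ^ 2 := div_le_self (sq_nonneg _) (by linarith)
    rw [sub_div]
    linarith
  have hsum := Finset.sum_le_sum fun p (_ : p ∈ Finset.univ) => hpt p
  rw [Finset.sum_sub_distrib, Finset.sum_neg_distrib, ← Finset.sum_div] at hsum
  have hS : ∑ p : α × α × α, swapDiff A π p.1 p.2.2 ^ 2
      = Fintype.card α * ∑ p : α × α, swapDiff A π p.1 p.2 ^ 2 := by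
    simp [Fintype.sum_prod_type, Finset.mul_sum]
  have hT := div_le_div_of_nonneg_right
    (card_mul_le_sum_swapDiff_mul_swap_sq hC hA hrow hcol π)
    (show 0 ≤ 1 + Real.exp R by positivity)
  have := (abs_le.1 hH).1
  linarith

end Gibbs

/-- The score of a Bernoulli-type pair with difference `y`. -/
def pairScore (t y : ℝ) : ℝ := y / (1 + Real.exp (t * y))

lemma continuous_pairScore (y : ℝ) : Continuous fun t => pairScore t y := by
  unfold pairScore
  refine continuous_const.div (by fun_prop) fun t => ?_
  positivity

lemma mul_exp_sub_exp_ge {s t y R : ℝ} (hst : s ≤ t) (hs : |s * y| ≤ R) (ht : |t * y| ≤ R) :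
    Real.exp (-R) * ((t - s) * y ^ 2) ≤ y * (Real.exp (t * y) - Real.exp (s * y)) := by
  have aux : ∀ a b : ℝ, a ≤ b → |a| ≤ R →
      Real.exp (-R) * (b - a) ≤ Real.exp b - Real.exp a := by
    intro a b hab ha
    have h1 : Real.exp b = Real.exp a * Real.exp (b - a) := by rw [← Real.exp_add]; ring_nf
    have h2 := Real.add_one_le_exp (b - a)
    have h3 : Real.exp (-R) ≤ Real.exp a := Real.exp_le_exp.2 (abs_le.1 ha).1
    have h4 := Real.exp_pos a
    calc Real.exp (-R) * (b - a) ≤ Real.exp a * (b - a) :=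
          mul_le_mul_of_nonneg_right h3 (by linarith)
      _ ≤ Real.exp a * (Real.exp (b - a) - 1) :=
          mul_le_mul_of_nonneg_left (by linarith) h4.le
      _ = _ := by rw [h1]; ring
  rcases le_total 0 y with hy | hy
  · have := mul_le_mul_of_nonneg_left (aux _ _ (mul_le_mul_of_nonneg_right hst hy) hs) hy
    linarith
  · have := mul_le_mul_of_nonneg_left (aux _ _ (mul_le_mul_of_nonpos_right hst hy) ht)
      (neg_nonneg.2 hy)
    linarith

lemma pairScore_sub_pairScore (s t y : ℝ) :
    pairScore s y - pairScore t y
      = y * (Real.exp (t * y) - Real.exp (s * y))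
        / ((1 + Real.exp (s * y)) * (1 + Real.exp (t * y))) := by
  have h1 := Real.exp_pos (s * y)
  have h2 := Real.exp_pos (t * y)
  unfold pairScore
  field_simp
  ring

lemma le_pairScore_sub_pairScore {s t y R : ℝ} (hst : s ≤ t) (hs : |s * y| ≤ R)
    (ht : |t * y| ≤ R) :
    Real.exp (-R) / (1 + Real.exp R) ^ 2 * ((t - s) * y ^ 2)
      ≤ pairScore s y - pairScore t y := by
  rw [pairScore_sub_pairScore, div_mul_eq_mul_div]
  have h0 : 0 ≤ Real.exp (-R) * ((t - s) * y ^ 2) :=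
    mul_nonneg (Real.exp_pos _).le (mul_nonneg (by linarith) (sq_nonneg _))
  have h1 : Real.exp (s * y) ≤ Real.exp R := Real.exp_le_exp.2 (abs_le.1 hs).2
  have h2 : Real.exp (t * y) ≤ Real.exp R := Real.exp_le_exp.2 (abs_le.1 ht).2
  have h3 := mul_exp_sub_exp_ge hst hs ht
  refine div_le_div₀ (h0.trans h3) h3 (by positivity) ?_
  rw [sq]
  gcongr

lemma strictAnti_pairScore {y : ℝ} (hy : y ≠ 0) : StrictAnti fun t => pairScore t y := by
  intro s t hst
  have h := le_pairScore_sub_pairScore hst.le (le_max_left |s * y| |t * y|) (le_max_right _ _)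
  have hy2 : 0 < y ^ 2 := by positivity
  have : 0 < Real.exp (-max |s * y| |t * y|) / (1 + Real.exp (max |s * y| |t * y|)) ^ 2
      * ((t - s) * y ^ 2) := mul_pos (by positivity) (mul_pos (by linarith) hy2)
  show pairScore t y < pairScore s y
  linarith

lemma antitone_pairScore (y : ℝ) : Antitone fun t => pairScore t y := by
  rcases eq_or_ne y 0 with rfl | hy
  · simp [pairScore, Antitone]
  · exact (strictAnti_pairScore hy).antitone

/-- If the total score at `θ` is small compared with the total squared difference, then the
score equation has a unique root, and this root is close to `θ`. -/
lemma existsUnique_sum_pairScore_eq_zero {ι : Type*} [Fintype ι] (y : ι → ℝ) {Y θ d : ℝ}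
    (hY : ∀ i, |y i| ≤ Y) (hd : 0 < d) (hd1 : d ≤ 1)
    (hθ : |∑ i, pairScore θ (y i)|
      < Real.exp (-((|θ| + 1) * Y)) / (1 + Real.exp ((|θ| + 1) * Y)) ^ 2 * (d * ∑ i, y i ^ 2)) :
    (∃! t, ∑ i, pairScore t (y i) = 0) ∧
      ∀ t, ∑ i, pairScore t (y i) = 0 → |t - θ| ≤ d := by
  set R := (|θ| + 1) * Y with hR
  set κ := Real.exp (-R) / (1 + Real.exp R) ^ 2 with hκ
  have hne : ∃ i, y i ≠ 0 := by
    by_contra! h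
    simp [h, pairScore] at hθ
  obtain ⟨i₀, hi₀⟩ := hne
  have hanti : StrictAnti fun t => ∑ i, pairScore t (y i) := fun s t hst =>
    Finset.sum_lt_sum (fun i _ => antitone_pairScore (y i) hst.le)
      ⟨i₀, Finset.mem_univ _, strictAnti_pairScore hi₀ hst⟩
  have hcont : Continuous fun t => ∑ i, pairScore t (y i) :=
    continuous_finsetSum _ fun i _ => continuous_pairScore (y i)
  have hbd : ∀ t, |t| ≤ |θ| + 1 → ∀ i, |t * y i| ≤ R := by
    intro t ht i
    rw [abs_mul]
    exact mul_le_mul ht (hY i) (abs_nonneg _) (by positivity)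
  have hθR : |θ| ≤ |θ| + 1 := by linarith
  have hd' : |d| ≤ 1 := by rwa [abs_of_pos hd]
  have hdiff : ∀ s t, s ≤ t → t - s = d → |s| ≤ |θ| + 1 → |t| ≤ |θ| + 1 →
      κ * (d * ∑ i, y i ^ 2) ≤ ∑ i, pairScore s (y i) - ∑ i, pairScore t (y i) := by
    intro s t hst hts hs ht
    rw [← Finset.sum_sub_distrib, Finset.mul_sum, Finset.mul_sum, ← hts]
    exact Finset.sum_le_sum fun i _ => le_pairScore_sub_pairScore hst (hbd s hs i) (hbd t ht i)
  have hright : ∑ i, pairScore (θ + d) (y i) < 0 := by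
    have := hdiff θ (θ + d) (by linarith) (by ring) hθR
      ((abs_add_le _ _).trans (by linarith))
    linarith [le_abs_self (∑ i, pairScore θ (y i))]
  have hleft : 0 < ∑ i, pairScore (θ - d) (y i) := by
    have := hdiff (θ - d) θ (by linarith) (by ring)
      ((abs_sub _ _).trans (by linarith)) hθR
    linarith [neg_abs_le (∑ i, pairScore θ (y i))]
  refine ⟨?_, fun t ht => ?_⟩
  · obtain ⟨t, -, ht⟩ := intermediate_value_Icc' (show θ - d ≤ θ + d by linarith)
      hcont.continuousOn ⟨hright.le, hleft.le⟩
    exact ⟨t, ht, fun s hs => hanti.injective (hs.trans ht.symm)⟩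
  · rw [abs_sub_le_iff]
    constructor
    · by_contra! h
      have := hanti (show θ + d < t by linarith)
      simp only at this
      linarith
    · by_contra! h
      have := hanti (show t < θ - d by linarith)
      simp only at this
      linarith

/-- Riemann sums of a continuous kernel along its second variable converge uniformly in the
first one. -/
lemma eventually_abs_sum_sub_integral_le {K : ℝ × ℝ → ℝ} (hK : Continuous K) {η : ℝ}
    (hη : 0 < η) :
    ∀ᶠ n : ℕ in atTop, ∀ x ∈ Set.Icc (0 : ℝ) 1,
      |∑ i : Fin n, K (x, (i.1 + 1 : ℝ) / n) - n * ∫ z in (0 : ℝ)..1, K (x, z)| ≤ η * n := by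
  have hcpt : IsCompact (Set.Icc (0 : ℝ) 1 ×ˢ Set.Icc (0 : ℝ) 1) := isCompact_Icc.prod isCompact_Icc
  obtain ⟨δ, hδ, hunif⟩ := Metric.uniformContinuousOn_iff.1
    (hcpt.uniformContinuousOn_of_continuous hK.continuousOn) η hη
  filter_upwards [eventually_gt_atTop 0, tendsto_natCast_atTop_atTop.eventually_gt_atTop (1 / δ)]
    with n hn hnδ x hx
  have hn' : (0 : ℝ) < n := by exact_mod_cast hn
  have hstep : (1 : ℝ) / n < δ := by
    rw [div_lt_iff₀ hn', mul_comm, ← div_lt_iff₀ hδ]; exact hnδ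
  have hcont : Continuous fun z => K (x, z) := by fun_prop
  have hsplit : ∫ z in (0 : ℝ)..1, K (x, z)
      = ∑ i : Fin n, ∫ z in (i.1 / n : ℝ)..((i.1 + 1) / n), K (x, z) := by
    have := intervalIntegral.sum_integral_adjacent_intervals (n := n) (μ := volume)
      (a := fun k : ℕ => (k / n : ℝ)) (f := fun z => K (x, z))
      fun k _ => hcont.intervalIntegrable _ _
    simp only [Nat.cast_zero, zero_div, div_self hn'.ne', Nat.cast_add, Nat.cast_one] at this
    rw [← this, ← Fin.sum_univ_eq_sum_range fun k : ℕ =>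
      ∫ z in (k / n : ℝ)..((k + 1) / n), K (x, z)]
  rw [hsplit, Finset.mul_sum, ← Finset.sum_sub_distrib]
  have hterm : ∀ i : Fin n, |K (x, (i.1 + 1 : ℝ) / n)
      - n * ∫ z in (i.1 / n : ℝ)..((i.1 + 1) / n), K (x, z)| ≤ η := by
    intro i
    have hi : (i.1 + 1 : ℝ) ≤ n := by exact_mod_cast i.2
    have hlen : (i.1 + 1 : ℝ) / n - i.1 / n = 1 / n := by ring
    have hle : (i.1 / n : ℝ) ≤ (i.1 + 1) / n := by gcongr; linarith
    have h0 : (0 : ℝ) ≤ i.1 / n := by positivity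
    have h1 : (i.1 + 1 : ℝ) / n ≤ 1 := (div_le_one hn').2 hi
    have hbound := intervalIntegral.norm_integral_le_of_norm_le_const
      (a := (i.1 / n : ℝ)) (b := (i.1 + 1) / n) (C := η)
      (f := fun z => K (x, (i.1 + 1 : ℝ) / n) - K (x, z)) fun z hz => by
        rw [Set.uIoc_of_le hle] at hz
        rw [← dist_eq_norm]
        refine (hunif _ ⟨hx, h0.trans hle, h1⟩ _ ⟨hx, h0.trans hz.1.le, hz.2.trans h1⟩ ?_).le
        rw [Prod.dist_eq, dist_self, max_lt_iff, Real.dist_eq, abs_lt]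
        refine ⟨hδ, ?_, ?_⟩ <;> linarith [hz.1, hz.2]
    rw [intervalIntegral.integral_sub intervalIntegrable_const (hcont.intervalIntegrable _ _),
      intervalIntegral.integral_const, hlen, smul_eq_mul, Real.norm_eq_abs,
      abs_of_pos (show (0 : ℝ) < 1 / n by positivity)] at hbound
    calc _ = n * |1 / n * K (x, (i.1 + 1 : ℝ) / n)
          - ∫ z in (i.1 / n : ℝ)..((i.1 + 1) / n), K (x, z)| := by
          rw [← abs_of_pos hn', ← abs_mul, abs_of_pos hn', mul_sub, ← mul_assoc,
            mul_one_div_cancel hn'.ne', one_mul]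
      _ ≤ n * (η * (1 / n)) := by gcongr
      _ = η := by field_simp
  refine (Finset.abs_sum_le_sum_abs _ _).trans ((Finset.sum_le_sum fun i _ => hterm i).trans_eq ?_)
  simp [mul_comm]

/-- The sampled kernel `(i, a) ↦ f(i/n, a/n)`. -/
def gridMatrix (f : ℝ × ℝ → ℝ) (n : ℕ) (i a : Fin n) : ℝ :=
  f ((i.1 + 1 : ℝ) / n, (a.1 + 1 : ℝ) / n)

lemma grid_mem_Icc {n : ℕ} (i : Fin n) : (i.1 + 1 : ℝ) / n ∈ Set.Icc (0 : ℝ) 1 := by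
  have hi : (i.1 + 1 : ℝ) ≤ n := by exact_mod_cast i.2
  exact ⟨by positivity, div_le_one_of_le₀ hi (by positivity)⟩

lemma eventually_le_sum_sum_of_continuous {K : ℝ × ℝ → ℝ} (hK : Continuous K)
    (hK0 : ∀ p, 0 ≤ K p) (hpos : ∃ p ∈ unitSq, 0 < K p) :
    ∃ c > 0, ∀ᶠ n : ℕ in atTop,
      c * (n : ℝ) ^ 2 ≤ ∑ i : Fin n, ∑ a : Fin n, gridMatrix K n i a := by
  set G : ℝ → ℝ := fun x => ∫ z in (0 : ℝ)..1, K (x, z) with hG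
  have hGc : Continuous G :=
    intervalIntegral.continuous_parametric_intervalIntegral_of_continuous' (f := fun x z => K (x, z))
      hK 0 1
  obtain ⟨⟨x₀, y₀⟩, ⟨hx₀, hy₀⟩, hp⟩ := hpos
  have hI : 0 < ∫ x in (0 : ℝ)..1, G x := by
    refine intervalIntegral.integral_pos one_pos hGc.continuousOn
      (fun x _ => intervalIntegral.integral_nonneg zero_le_one fun z _ => hK0 _) ⟨x₀, hx₀, ?_⟩
    exact intervalIntegral.integral_pos one_pos
      (show Continuous fun z => K (x₀, z) by fun_prop).continuousOn (fun z _ => hK0 _)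
      ⟨y₀, hy₀, hp⟩
  set I := ∫ x in (0 : ℝ)..1, G x with hIdef
  refine ⟨I / 2, by positivity, ?_⟩
  filter_upwards [eventually_abs_sum_sub_integral_le hK (show 0 < I / 4 by positivity),
    eventually_abs_sum_sub_integral_le (K := fun p => G p.2) (by fun_prop)
      (show 0 < I / 4 by positivity)] with n h1 h2
  have h2' := (abs_le.1 (h2 0 (by simp))).1
  have h1' : ∀ i : Fin n, n * G ((i.1 + 1 : ℝ) / n) - I / 4 * n ≤ ∑ a, gridMatrix K n i a := by
    intro i
    have := (abs_le.1 (h1 _ (grid_mem_Icc i))).1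
    simp only [gridMatrix, hG]
    linarith
  have hsum := Finset.sum_le_sum fun i (_ : i ∈ Finset.univ) => h1' i
  rw [Finset.sum_sub_distrib, ← Finset.mul_sum] at hsum
  simp only [Finset.sum_const, Finset.card_univ, Fintype.card_fin, nsmul_eq_mul] at hsum
  rw [← hIdef] at h2'
  have hn : (0 : ℝ) ≤ n := n.cast_nonneg
  nlinarith [mul_le_mul_of_nonneg_left h2' hn]

/-- Analytic properties of the sampled kernel of a function in `𝓒`. -/
lemma memC.gridMatrix_bounds {f : ℝ × ℝ → ℝ} (hf : memC f) :
    ∃ C > 0, ∃ c > 0, (∀ n i a, |gridMatrix f n i a| ≤ C) ∧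
      ∀ η > 0, ∀ᶠ n : ℕ in atTop, (∀ i, |∑ a, gridMatrix f n i a| ≤ η * n) ∧
        (∀ a, |∑ i, gridMatrix f n i a| ≤ η * n) ∧
        c * (n : ℝ) ^ 2 ≤ ∑ i, ∑ a, gridMatrix f n i a ^ 2 := by
  obtain ⟨hcont, ⟨p, hp, hfp⟩, hx, hy⟩ := hf
  set pr : ℝ → ℝ := fun x => Set.projIcc (0 : ℝ) 1 zero_le_one x with hpr
  have hprc : Continuous pr := continuous_subtype_val.comp continuous_projIcc
  have hprm : ∀ x, pr x ∈ Set.Icc (0 : ℝ) 1 := fun x => (Set.projIcc (0 : ℝ) 1 zero_le_one x).2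
  have hpre : ∀ x ∈ Set.Icc (0 : ℝ) 1, pr x = x := fun x hx => by
    simp only [hpr, Set.projIcc_of_mem zero_le_one hx]
  set g : ℝ × ℝ → ℝ := fun q => f (pr q.1, pr q.2) with hg
  have hgc : Continuous g := hcont.comp_continuous (by fun_prop) fun q => ⟨hprm _, hprm _⟩
  have hgf : ∀ x ∈ Set.Icc (0 : ℝ) 1, ∀ y ∈ Set.Icc (0 : ℝ) 1, g (x, y) = f (x, y) :=
    fun x hx y hy => by simp only [hg, hpre x hx, hpre y hy]
  have hgrid : ∀ n i a, gridMatrix f n i a = gridMatrix g n i a := fun n i a =>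
    (hgf _ (grid_mem_Icc i) _ (grid_mem_Icc a)).symm
  have hgx : ∀ x ∈ Set.Icc (0 : ℝ) 1, ∫ z in (0 : ℝ)..1, g (x, z) = 0 := fun x hx' => by
    refine Eq.trans ?_ (hx x hx')
    refine intervalIntegral.integral_congr fun z hz => ?_
    rw [Set.uIcc_of_le zero_le_one] at hz
    exact hgf x hx' z hz
  have hgy : ∀ y ∈ Set.Icc (0 : ℝ) 1, ∫ z in (0 : ℝ)..1, g (z, y) = 0 := fun y hy' => by
    refine Eq.trans ?_ (hy y hy')
    refine intervalIntegral.integral_congr fun z hz => ?_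
    rw [Set.uIcc_of_le zero_le_one] at hz
    exact hgf z hz y hy'
  have hcpt : IsCompact unitSq := isCompact_Icc.prod isCompact_Icc
  obtain ⟨C, hC⟩ := hcpt.exists_bound_of_continuousOn hcont
  obtain ⟨c, hc, hsq⟩ := eventually_le_sum_sum_of_continuous (K := fun q => g q ^ 2)
    (by fun_prop) (fun q => sq_nonneg _) ⟨p, hp, by
      have : g p = f p := hgf p.1 hp.1 p.2 hp.2
      simp only [this]
      positivity⟩
  refine ⟨|C| + 1, by positivity, c, hc, fun n i a => ?_, fun η hη => ?_⟩
  · exact ((hC _ ⟨grid_mem_Icc i, grid_mem_Icc a⟩).trans (le_abs_self C)).trans (by linarith)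
  filter_upwards [hsq, eventually_abs_sum_sub_integral_le hgc hη,
    eventually_abs_sum_sub_integral_le (K := fun q => g (q.2, q.1)) (by fun_prop) hη]
    with n h1 h2 h3
  simp only [hgrid]
  refine ⟨fun i => ?_, fun a => ?_, h1⟩
  · have := h2 _ (grid_mem_Icc i)
    rwa [hgx _ (grid_mem_Icc i), mul_zero, sub_zero] at this
  · have := h3 _ (grid_mem_Icc a)
    rwa [hgy _ (grid_mem_Icc a), mul_zero, sub_zero] at this

lemma two_mul_PLn (f : ℝ × ℝ → ℝ) (n : ℕ) (π : Equiv.Perm (Fin n)) (t : ℝ) :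
    2 * PLn f n π t
      = ∑ p : Fin n × Fin n, pairScore t (swapDiff (gridMatrix f n) π p.1 p.2) := by
  set F : Fin n × Fin n → ℝ :=
    fun p => pairScore t (swapDiff (gridMatrix f n) π p.1 p.2) with hF
  have hPL : PLn f n π t = ∑ p : Fin n × Fin n, if p.1 < p.2 then F p else 0 := by
    unfold PLn
    rw [Finset.sum_filter]
    refine Finset.sum_congr rfl fun p _ => ?_
    split_ifs <;> rfl
  have hswap : ∑ p : Fin n × Fin n, (if p.1 < p.2 then F p else 0)
      = ∑ p : Fin n × Fin n, if p.2 < p.1 then F p else 0 := by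
    rw [← Equiv.sum_comp (Equiv.prodComm (Fin n) (Fin n))]
    refine Finset.sum_congr rfl fun p _ => ?_
    simp [hF, swapDiff_comm _ _ p.2 p.1]
  rw [two_mul, hPL]
  nth_rewrite 2 [hswap]
  rw [← Finset.sum_add_distrib]
  refine Finset.sum_congr rfl fun p _ => ?_
  rcases lt_trichotomy p.1 p.2 with h | h | h
  · simp [h, h.le.not_gt]
  · simp [h, hF, swapDiff_self, pairScore]
  · simp [h, h.le.not_gt]

lemma isGibbsWeight_Qprob (f : ℝ × ℝ → ℝ) (θ : ℝ) (n : ℕ) :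
    IsGibbsWeight (gridMatrix f n) θ fun π => Real.exp (θ * permStat f n π - Zn f θ n) where
  nonneg π := (Real.exp_pos _).le
  sum_eq_one := by
    have hpos : 0 < ∑ π : Equiv.Perm (Fin n), Real.exp (θ * permStat f n π) :=
      Finset.sum_pos (fun π _ => Real.exp_pos _) Finset.univ_nonempty
    simp only [Real.exp_sub, Zn, Real.exp_log hpos]
    rw [← Finset.sum_div, div_self hpos.ne']
  mul_swap π i j := by
    rw [← Real.exp_add]
    have : permStat f n (π * Equiv.swap i j)
        = permStat f n π - swapDiff (gridMatrix f n) π i j :=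
      sum_mul_swap_apply (gridMatrix f n) π i j
    rw [this]
    ring_nf

lemma Qprob_mono (f : ℝ × ℝ → ℝ) (θ : ℝ) (n : ℕ) {p q : Equiv.Perm (Fin n) → Prop}
    (h : ∀ π, p π → q π) : Qprob f θ n p ≤ Qprob f θ n q := by
  classical
  refine Finset.sum_le_sum fun π _ => ?_
  split_ifs with h1 h2 h2
  exacts [le_rfl, absurd (h π h1) h2, (Real.exp_pos _).le, le_rfl]

lemma Qprob_nonneg (f : ℝ × ℝ → ℝ) (θ : ℝ) (n : ℕ) (p : Equiv.Perm (Fin n) → Prop) :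
    0 ≤ Qprob f θ n p := by
  classical
  refine Finset.sum_nonneg fun π _ => ?_
  split_ifs
  exacts [(Real.exp_pos _).le, le_rfl]

lemma Qprob_add_Qprob_not (f : ℝ × ℝ → ℝ) (θ : ℝ) (n : ℕ) (p : Equiv.Perm (Fin n) → Prop) :
    Qprob f θ n p + Qprob f θ n (fun π => ¬ p π) = 1 := by
  classical
  rw [← (isGibbsWeight_Qprob f θ n).sum_eq_one, Qprob, Qprob, ← Finset.sum_add_distrib]
  refine Finset.sum_congr rfl fun π _ => ?_
  by_cases h : p π <;> simp [h]

lemma Qprob_or_le (f : ℝ × ℝ → ℝ) (θ : ℝ) (n : ℕ) (p q : Equiv.Perm (Fin n) → Prop) :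
    Qprob f θ n (fun π => p π ∨ q π) ≤ Qprob f θ n p + Qprob f θ n q := by
  classical
  rw [Qprob, Qprob, Qprob, ← Finset.sum_add_distrib]
  refine Finset.sum_le_sum fun π _ => ?_
  have := Real.exp_pos (θ * permStat f n π - Zn f θ n)
  by_cases h1 : p π <;> by_cases h2 : q π <;> simp [h1, h2, this.le]

/-- With probability close to one, the estimating equation has a unique root, and all its roots
are within `M / √n` of the true parameter. -/
lemma memC.eventually_Qprob_not_le {f : ℝ × ℝ → ℝ} (hf : memC f) (θ : ℝ) {ε : ℝ} (hε : 0 < ε) :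
    ∃ M : ℝ, ∀ᶠ n : ℕ in atTop,
      Qprob f θ n (fun π => ¬ ((∃! t : ℝ, PLn f n π t = 0) ∧
        ∀ t, PLn f n π t = 0 → Real.sqrt n * |t - θ| ≤ M)) ≤ ε := by
  classical
  obtain ⟨C, hC, c, hc, hA, hgrid⟩ := hf.gridMatrix_bounds
  set R := (|θ| + 1) * (4 * C) with hR
  set κ := Real.exp (-R) / (1 + Real.exp R) ^ 2 with hκ
  have hκ0 : 0 < κ := by positivity
  set δ := c / (4 * (1 + Real.exp R)) with hδ
  have hδ0 : 0 < δ := by positivity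
  set K := 16 * C / Real.sqrt ε with hK
  have hK0 : 0 < K := by positivity
  have hK2 : 128 * C ^ 2 / K ^ 2 = ε / 2 := by
    rw [hK, div_pow, Real.sq_sqrt hε.le]
    field_simp
    norm_num
  set M := 2 * K / (κ * δ) with hM
  have hM0 : 0 < M := by positivity
  refine ⟨M, ?_⟩
  filter_upwards [hgrid (c / (12 * C)) (by positivity), eventually_gt_atTop 0,
    tendsto_natCast_atTop_atTop.eventually_ge_atTop (M ^ 2),
    tendsto_natCast_atTop_atTop.eventually_ge_atTop (2 * (3072 * C ^ 4 / δ ^ 2) / ε)]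
    with n ⟨hrow, hcol, hsq⟩ hn hnM hnε
  have hn' : (0 : ℝ) < n := by exact_mod_cast hn
  have hs : 0 < Real.sqrt n := Real.sqrt_pos.2 hn'
  have hss : Real.sqrt n ^ 2 = n := Real.sq_sqrt hn'.le
  have hw := isGibbsWeight_Qprob f θ n
  set S : Equiv.Perm (Fin n) → ℝ := fun π =>
    ∑ p : Fin n × Fin n, pairScore θ (swapDiff (gridMatrix f n) π p.1 p.2) with hS
  set H : Equiv.Perm (Fin n) → ℝ := fun π => ∑ p : Fin n × Fin n × Fin n,
    (swapDiff (gridMatrix f n) π p.1 p.2.2 ^ 2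
      - swapDiff (gridMatrix f n) (π * Equiv.swap p.1 p.2.1) p.1 p.2.2 ^ 2)
        / (1 + Real.exp (θ * swapDiff (gridMatrix f n) π p.1 p.2.1)) with hH
  have hPS : Qprob f θ n (fun π => K * (n * Real.sqrt n) < |S π|) ≤ ε / 2 := by
    refine (sum_ite_lt_abs_le _ hw.nonneg S (by positivity)
      (hw.sum_mul_score_sq_le (hA n))).trans_eq ?_
    rw [← hK2, Fintype.card_fin, mul_pow, mul_pow, hss]
    field_simp
  have hPH : Qprob f θ n (fun π => δ * (n : ℝ) ^ 3 < |H π|) ≤ ε / 2 := by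
    refine (sum_ite_lt_abs_le _ hw.nonneg H (by positivity)
      (hw.sum_mul_fluctuation_sq_le (hA n))).trans ?_
    rw [div_le_iff₀ hε] at hnε
    rw [Fintype.card_fin, show 3072 * C ^ 4 * (n : ℝ) ^ 5 / (δ * (n : ℝ) ^ 3) ^ 2
      = 3072 * C ^ 4 / δ ^ 2 / n by field_simp, div_le_iff₀ hn']
    linarith
  refine (Qprob_mono f θ n ?_).trans ((Qprob_or_le f θ n _ _).trans
    ((add_le_add hPS hPH).trans_eq (add_halves ε)))
  intro π
  contrapose!
  rintro ⟨hSπ, hHπ⟩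
  have hθR : |θ| * (4 * C) ≤ R := by rw [hR]; gcongr; linarith
  have hlow := le_card_mul_sum_swapDiff_sq hC.le (hA n) hrow hcol hθR π hHπ
  rw [Fintype.card_fin] at hlow
  have hsum : δ * (n : ℝ) ^ 2
      ≤ ∑ p : Fin n × Fin n, swapDiff (gridMatrix f n) π p.1 p.2 ^ 2 := by
    have h1 : c / 2 * (n : ℝ) ^ 2 ≤ ∑ i, ∑ a, gridMatrix f n i a ^ 2
        - 6 * (n * (C * (c / (12 * C) * n))) := by
      have : 6 * (n * (C * (c / (12 * C) * n))) = c / 2 * (n : ℝ) ^ 2 := by field_simp; norm_num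
      rw [this]
      linarith
    have h2 : n * (c / 2 * (n : ℝ) ^ 2) / (1 + Real.exp R) = 2 * (δ * (n : ℝ) ^ 3) := by
      rw [hδ]; field_simp; norm_num
    have h3 : n * (c / 2 * (n : ℝ) ^ 2) / (1 + Real.exp R) ≤ n * (∑ i, ∑ a, gridMatrix f n i a ^ 2
        - 6 * (n * (C * (c / (12 * C) * n)))) / (1 + Real.exp R) := by gcongr
    refine le_of_mul_le_mul_left ?_ hn'
    linarith [show n * (δ * (n : ℝ) ^ 2) = δ * (n : ℝ) ^ 3 by ring]
  have hd1 : M / Real.sqrt n ≤ 1 := by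
    rw [div_le_one hs]
    exact Real.le_sqrt_of_sq_le hnM
  have hscore : |S π| < κ * (M / Real.sqrt n
      * ∑ p : Fin n × Fin n, swapDiff (gridMatrix f n) π p.1 p.2 ^ 2) := by
    calc |S π| ≤ K * (n * Real.sqrt n) := hSπ
      _ < 2 * (K * (n * Real.sqrt n)) := by
          have : 0 < K * (n * Real.sqrt n) := by positivity
          linarith
      _ = κ * (M / Real.sqrt n * (δ * (n : ℝ) ^ 2)) := by
          rw [hM, show (n : ℝ) ^ 2 = Real.sqrt n * (n * Real.sqrt n) by
            linear_combination -(n : ℝ) * hss]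
          field_simp
      _ ≤ _ := by gcongr
  have hroot := existsUnique_sum_pairScore_eq_zero
    (fun p : Fin n × Fin n => swapDiff (gridMatrix f n) π p.1 p.2)
    (fun p => abs_swapDiff_le (hA n) π p.1 p.2) (by positivity) hd1 hscore
  simp only [← two_mul_PLn, mul_eq_zero, two_ne_zero, false_or] at hroot
  refine ⟨hroot.1, fun t ht => ?_⟩
  rw [mul_comm, ← le_div_iff₀ hs]
  exact hroot.2 t ht

/-- The pseudo-likelihood estimating equation has a unique root with
probability tending to one, and this root is `√n`-consistent for `θ₀`. -/
theorem pseudolikelihood_root_consistent (f : ℝ × ℝ → ℝ) (hf : memC f) (θ₀ : ℝ) :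
    Tendsto (fun n : ℕ => Qprob f θ₀ n (fun π => ∃! t : ℝ, PLn f n π t = 0))
      atTop (𝓝 1) ∧
    ∀ ε > 0, ∃ M : ℝ,
      Filter.limsup
        (fun n : ℕ => Qprob f θ₀ n
          (fun π => ∃ t : ℝ, PLn f n π t = 0 ∧ M < Real.sqrt n * |t - θ₀|))
        atTop ≤ ε := by
  refine ⟨?_, fun ε hε => ?_⟩
  · rw [Metric.tendsto_atTop']
    intro ε hε
    obtain ⟨M, hM⟩ := hf.eventually_Qprob_not_le θ₀ (half_pos hε)
    obtain ⟨N, hN⟩ := eventually_atTop.1 hM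
    refine ⟨N, fun n hn => ?_⟩
    have h1 := Qprob_add_Qprob_not f θ₀ n fun π => ∃! t : ℝ, PLn f n π t = 0
    have h2 : Qprob f θ₀ n (fun π => ¬ ∃! t : ℝ, PLn f n π t = 0) ≤ ε / 2 := by
      refine (Qprob_mono f θ₀ n ?_).trans (hN n hn.le)
      exact fun π hπ h => hπ h.1
    have h3 := Qprob_nonneg f θ₀ n fun π => ¬ ∃! t : ℝ, PLn f n π t = 0
    rw [Real.dist_eq, abs_lt]
    constructor <;> linarith
  · obtain ⟨M, hM⟩ := hf.eventually_Qprob_not_le θ₀ hε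
    refine ⟨M, limsup_le_of_le ?_ ?_⟩
    · exact isCoboundedUnder_le_of_le atTop (x := 0) fun n => Qprob_nonneg f θ₀ n _
    · filter_upwards [hM] with n hn
      refine (Qprob_mono f θ₀ n ?_).trans hn
      rintro π ⟨t, ht, hlt⟩ h
      exact absurd (h.2 t ht) (not_le.2 hlt)
end
end

section
/- For every θ ∈ ℝ, lim_{n→∞} (C_n(θ) − log n!)/n exists and equals C(θ) := sup_{μ ∈ 𝓜} { (θ/2)(μ×μ)(h) − D(μ||u) }. -/
open MeasureTheory Filter Topology
open scoped ENNReal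

noncomputable section

open scoped Classical in
/-- `Inv(π)`, the number of inversions of `π`. -/
def numInv (n : ℕ) (π : Equiv.Perm (Fin n)) : ℕ :=
  (Finset.univ.filter (fun p : Fin n × Fin n => p.1 < p.2 ∧ π p.2 < π p.1)).card

/-- `C_n(θ)`, the log normalizing constant of the Mallows model with Kendall's tau. -/
def Cn (θ : ℝ) (n : ℕ) : ℝ :=
  Real.log (∑ π : Equiv.Perm (Fin n), Real.exp (θ / n * numInv n π))

/-- `(μ×μ)(h)` where `h((x₁,y₁),(x₂,y₂)) = 1{(x₁−x₂)(y₁−y₂) < 0}`. -/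
def Hfun (μ : Measure (ℝ × ℝ)) : ℝ :=
  ((μ.prod μ) {p : (ℝ × ℝ) × (ℝ × ℝ) | (p.1.1 - p.2.1) * (p.1.2 - p.2.2) < 0}).toReal

/-- The Mallows objective `(θ/2)(μ×μ)(h) − D(μ‖u)`, as an extended real. -/
def objM (θ : ℝ) (μ : Measure (ℝ × ℝ)) : EReal :=
  ((θ / 2 * Hfun μ : ℝ) : EReal) - (KL μ usq : EReal)

theorem continuous_measure_Iio_toReal (ν : Measure ℝ) [IsFiniteMeasure ν] [NullSingletonClass ν] :
    Continuous fun t => (ν (Set.Iio t)).toReal := by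
  have h : (fun t => (ν (Set.Iio t)).toReal)
      = fun t => ∫ s, (Set.Iio t).indicator (fun _ => (1 : ℝ)) s ∂ν := by
    ext t
    rw [integral_indicator measurableSet_Iio]
    simp [Measure.real]
  rw [h, continuous_iff_continuousAt]
  intro t₀
  apply continuousAt_of_dominated (bound := fun _ => 1)
  · exact Eventually.of_forall fun t =>
      (measurable_const.indicator measurableSet_Iio).aestronglyMeasurable
  · refine Eventually.of_forall fun t => Eventually.of_forall fun s => ?_
    by_cases hs : s ∈ Set.Iio t <;> simp [hs]
  · exact integrable_const _
  · have h0 : ∀ᵐ s ∂ν, s ≠ t₀ := by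
      rw [ae_iff]; simp
    filter_upwards [h0] with s hs
    rcases lt_or_gt_of_ne hs with h1 | h1
    · refine ContinuousAt.congr (continuousAt_const (y := (1 : ℝ))) ?_
      filter_upwards [lt_mem_nhds h1] with t ht
      simp [ht]
    · refine ContinuousAt.congr (continuousAt_const (y := (0 : ℝ))) ?_
      filter_upwards [gt_mem_nhds h1] with t ht
      simp [ht.le]

/-- Probability integral transform for an atomless finite measure. -/
theorem map_measure_Iio_toReal (ν : Measure ℝ) [IsFiniteMeasure ν] [NullSingletonClass ν] :
    ν.map (fun t => (ν (Set.Iio t)).toReal)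
      = volume.restrict (Set.Icc 0 (ν Set.univ).toReal) := by
  have hcont := continuous_measure_Iio_toReal ν
  have hfin : ∀ s, ν s ≠ ∞ := fun s => measure_ne_top ν s
  have hmono : Monotone fun t => (ν (Set.Iio t)).toReal := fun s t hst =>
    ENNReal.toReal_mono (hfin _) (measure_mono (Set.Iio_subset_Iio hst))
  have hle : ∀ t, (ν (Set.Iio t)).toReal ≤ (ν Set.univ).toReal := fun t =>
    ENNReal.toReal_mono (hfin _) (measure_mono (Set.subset_univ _))
  refine Measure.ext_of_Iic _ _ fun a => ?_
  rw [Measure.map_apply hcont.measurable measurableSet_Iic, Measure.restrict_apply measurableSet_Iic]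
  rcases lt_or_ge a 0 with ha | ha
  · have h1 : (fun t => (ν (Set.Iio t)).toReal) ⁻¹' Set.Iic a = ∅ := by
      ext t
      simpa using ha.trans_le ENNReal.toReal_nonneg
    have h2 : Set.Iic a ∩ Set.Icc 0 (ν Set.univ).toReal = ∅ := by
      ext t
      simp only [Set.mem_inter_iff, Set.mem_Iic, Set.mem_Icc, Set.mem_empty_iff_false, iff_false]
      rintro ⟨h, h', _⟩
      linarith
    rw [h1, h2]; simp
  rcases le_or_gt (ν Set.univ).toReal a with hm | hm
  · have h1 : (fun t => (ν (Set.Iio t)).toReal) ⁻¹' Set.Iic a = Set.univ := by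
      ext t
      simpa using (hle t).trans hm
    have h2 : Set.Iic a ∩ Set.Icc 0 (ν Set.univ).toReal = Set.Icc 0 (ν Set.univ).toReal := by
      ext t
      simp only [Set.mem_inter_iff, Set.mem_Iic, Set.mem_Icc, and_iff_right_iff_imp]
      rintro ⟨_, h⟩
      linarith
    rw [h1, h2, Real.volume_Icc, sub_zero, ENNReal.ofReal_toReal (hfin _)]
  · have h2 : Set.Iic a ∩ Set.Icc 0 (ν Set.univ).toReal = Set.Icc 0 a := by
      ext t
      simp only [Set.mem_inter_iff, Set.mem_Iic, Set.mem_Icc]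
      constructor
      · rintro ⟨h, h', _⟩; exact ⟨h', h⟩
      · rintro ⟨h, h'⟩; exact ⟨h', h, h'.trans hm.le⟩
    rw [h2, Real.volume_Icc, sub_zero]
    set S := (fun t => (ν (Set.Iio t)).toReal) ⁻¹' Set.Iic a with hS
    have hcompl : ∀ t, (ν (Set.Ici t)).toReal = (ν Set.univ).toReal - (ν (Set.Iio t)).toReal := by
      intro t
      have := measure_add_measure_compl (μ := ν) (measurableSet_Iio (a := t))
      rw [Set.compl_Iio] at this
      rw [← this, ENNReal.toReal_add (hfin _) (hfin _)]; ring
    rcases S.eq_empty_or_nonempty with hemp | hne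
    · have : a ≤ 0 := by
        have hlim : Tendsto (fun t : ℝ => (ν (Set.Ici t)).toReal) atBot (𝓝 (ν Set.univ).toReal) :=
          (ENNReal.tendsto_toReal (hfin _)).comp (tendsto_measure_Ici_atBot ν)
        have : (ν Set.univ).toReal ≤ (ν Set.univ).toReal - a := by
          refine le_of_tendsto hlim (Eventually.of_forall fun t => ?_)
          have ht : t ∉ S := by simp [hemp]
          have ht' : a < (ν (Set.Iio t)).toReal := by simpa [hS] using ht
          rw [hcompl]; linarith
        linarith
      rw [hemp, measure_empty, ENNReal.ofReal_of_nonpos this]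
    · have hclosed : IsClosed S := isClosed_Iic.preimage hcont
      have hbdd : BddAbove S := by
        have hlim : Tendsto (fun t : ℝ => (ν (Set.Iic t)).toReal) atTop (𝓝 (ν Set.univ).toReal) :=
          (ENNReal.tendsto_toReal (hfin _)).comp (tendsto_measure_Iic_atTop ν)
        obtain ⟨t, ht⟩ := (hlim.eventually (lt_mem_nhds hm)).exists
        refine ⟨t, fun s hs => ?_⟩
        by_contra! hts
        have h3 : (ν (Set.Iic t)).toReal ≤ (ν (Set.Iio s)).toReal :=
          ENNReal.toReal_mono (hfin _) (measure_mono (Set.Iic_subset_Iio.2 hts))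
        have h4 : (ν (Set.Iio s)).toReal ≤ a := hs
        linarith
      have hmem : sSup S ∈ S := hclosed.csSup_mem hne hbdd
      have hSeq : S = Set.Iic (sSup S) := by
        ext t
        exact ⟨fun h => le_csSup hbdd h, fun h => (hmono h).trans hmem⟩
      have hval : (ν (Set.Iio (sSup S))).toReal = a := by
        refine le_antisymm hmem ?_
        have hlim : Tendsto (fun t => (ν (Set.Iio t)).toReal) (𝓝[>] (sSup S))
            (𝓝 (ν (Set.Iio (sSup S))).toReal) := hcont.continuousAt.mono_left nhdsWithin_le_nhds
        refine ge_of_tendsto hlim ?_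
        filter_upwards [self_mem_nhdsWithin] with t ht
        have : t ∉ S := fun h => not_le_of_gt ht (le_csSup hbdd h)
        exact (not_le.1 this).le
      rw [hSeq, measure_congr Iio_ae_eq_Iic.symm, ← hval, ENNReal.ofReal_toReal (hfin _)]

theorem lintegral_comp_measure_Iio (ν : Measure ℝ) [IsFiniteMeasure ν] [NullSingletonClass ν]
    {g : ℝ → ℝ≥0∞} (hg : Measurable g) :
    ∫⁻ t, g (ν (Set.Iio t)).toReal ∂ν = ∫⁻ t in Set.Icc 0 (ν Set.univ).toReal, g t := by
  rw [← map_measure_Iio_toReal, lintegral_map hg (continuous_measure_Iio_toReal ν).measurable]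

theorem lintegral_comp_measure_Ioi (ν : Measure ℝ) [IsFiniteMeasure ν] [NullSingletonClass ν]
    {g : ℝ → ℝ≥0∞} (hg : Measurable g) :
    ∫⁻ t, g (ν (Set.Ioi t)).toReal ∂ν = ∫⁻ t in Set.Icc 0 (ν Set.univ).toReal, g t := by
  have h : ∀ t, (ν (Set.Ioi t)).toReal = (ν Set.univ).toReal - (ν (Set.Iio t)).toReal := by
    intro t
    have := measure_add_measure_compl (μ := ν) (measurableSet_Iio (a := t))
    rw [Set.compl_Iio, ← measure_congr (Ioi_ae_eq_Ici (μ := ν) (a := t))] at this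
    rw [← this, ENNReal.toReal_add (measure_ne_top _ _) (measure_ne_top _ _)]; ring
  simp_rw [h]
  rw [lintegral_comp_measure_Iio ν (g := fun s => g ((ν Set.univ).toReal - s))
    (hg.comp (measurable_const.sub measurable_id))]
  have := (Measure.measurePreserving_sub_left (volume : Measure ℝ) (ν Set.univ).toReal).restrict_preimage
    (s := Set.Icc 0 (ν Set.univ).toReal) measurableSet_Icc
  rw [← this.lintegral_comp hg]
  congr 2
  ext t
  simp

/-- The permutation with `0 ↦ p` whose remaining entries are ordered like `e`. -/
def permCons {n : ℕ} (p : Fin (n + 1)) (e : Equiv.Perm (Fin n)) : Equiv.Perm (Fin (n + 1)) :=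
  p.cycleRange.symm * Equiv.Perm.decomposeFin.symm (0, e)

theorem permCons_zero {n : ℕ} (p : Fin (n + 1)) (e : Equiv.Perm (Fin n)) :
    permCons p e 0 = p := by
  simp [permCons, Equiv.Perm.mul_apply]

theorem permCons_succ {n : ℕ} (p : Fin (n + 1)) (e : Equiv.Perm (Fin n)) (i : Fin n) :
    permCons p e i.succ = p.succAbove (e i) := by
  rw [permCons, Equiv.Perm.mul_apply, Equiv.Perm.decomposeFin_symm_apply_succ, Equiv.swap_self]
  simp only [Equiv.refl_apply]
  exact Fin.cycleRange_symm_succ _ _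

theorem permCons_bijective (n : ℕ) :
    Function.Bijective fun x : Fin (n + 1) × Equiv.Perm (Fin n) => permCons x.1 x.2 := by
  rw [Fintype.bijective_iff_injective_and_card]
  constructor
  · rintro ⟨p, e⟩ ⟨p', e'⟩ h
    have h0 : p = p' := by
      simpa [permCons_zero] using congrArg (fun π : Equiv.Perm (Fin (n + 1)) => π 0) h
    subst h0
    have h1 : e = e' := by
      ext i
      have := congrArg (fun π : Equiv.Perm (Fin (n + 1)) => π i.succ) h
      simp only [permCons_succ] at this
      rw [Fin.succAbove_right_injective this]
    rw [h1]
  · simp [Fintype.card_perm, Nat.factorial_succ]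

theorem numInv_eq_sum (n : ℕ) (π : Equiv.Perm (Fin n)) :
    numInv n π = ∑ i, ∑ j, if i < j ∧ π j < π i then 1 else 0 := by
  classical
  rw [numInv, Finset.card_filter, Fintype.sum_prod_type]

theorem numInv_permCons {n : ℕ} (p : Fin (n + 1)) (e : Equiv.Perm (Fin n)) :
    numInv (n + 1) (permCons p e) = p + numInv n e := by
  have hp : (∑ j : Fin n, if permCons p e j.succ < p then 1 else 0) = (p : ℕ) := by
    have h1 : (∑ k, if permCons p e k < p then 1 else 0) = (p : ℕ) := by
      rw [Equiv.sum_comp (permCons p e) (fun k => if k < p then 1 else 0), ← Finset.card_filter]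
      have : Finset.univ.filter (fun k => k < p) = Finset.Iio p := by ext; simp
      rw [this, Fin.card_Iio]
    rw [Fin.sum_univ_succ] at h1
    simpa [permCons_zero] using h1
  rw [numInv_eq_sum, numInv_eq_sum, Fin.sum_univ_succ, Fin.sum_univ_succ]
  simp only [Fin.sum_univ_succ (n := n), permCons_zero, permCons_succ, lt_self_iff_false,
    false_and, if_false, zero_add, Fin.succ_pos, true_and, Fin.succ_lt_succ_iff, Fin.not_lt_zero,
    Fin.succAbove_lt_succAbove_iff] at hp ⊢
  rw [hp]

theorem sum_pow_numInv (q : ℝ) (n : ℕ) :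
    ∑ π : Equiv.Perm (Fin n), q ^ numInv n π
      = ∏ i ∈ Finset.range n, ∑ j ∈ Finset.range (i + 1), q ^ j := by
  induction n with
  | zero => simp [numInv]
  | succ n ih =>
    rw [Finset.prod_range_succ, ← ih,
      ← (permCons_bijective n).sum_comp (fun π => q ^ numInv (n + 1) π), Fintype.sum_prod_type]
    simp only [numInv_permCons, pow_add, ← Finset.mul_sum]
    rw [← Finset.sum_mul, Fin.sum_univ_eq_sum_range (fun j => q ^ j) (n + 1), mul_comm]

/-- Right-endpoint Riemann sums of a continuous function converge. -/
theorem tendsto_riemann_sum {g : ℝ → ℝ} (hg : Continuous g) :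
    Tendsto (fun n : ℕ => (∑ i ∈ Finset.range n, g ((i + 1 : ℝ) / n)) / n) atTop
      (𝓝 (∫ x in (0 : ℝ)..1, g x)) := by
  have huc : UniformContinuousOn g (Set.Icc 0 1) :=
    isCompact_Icc.uniformContinuousOn_of_continuous hg.continuousOn
  rw [Metric.tendsto_atTop]
  intro ε hε
  obtain ⟨δ, hδ, H⟩ := Metric.uniformContinuousOn_iff_le.1 huc (ε / 2) (half_pos hε)
  obtain ⟨N, hN⟩ := exists_nat_one_div_lt hδ
  refine ⟨N + 1, fun n hn => ?_⟩
  have hn0 : (0 : ℝ) < n := by exact_mod_cast (Nat.succ_pos N).trans_le hn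
  have hnδ : 1 / (n : ℝ) < δ := by
    refine lt_of_le_of_lt ?_ hN
    apply one_div_le_one_div_of_le (by positivity)
    exact_mod_cast hn
  have hsplit : ∫ x in (0 : ℝ)..1, g x
      = ∑ i ∈ Finset.range n, ∫ x in ((i : ℕ) / n : ℝ)..((i + 1 : ℕ) / n : ℝ), g x := by
    rw [intervalIntegral.sum_integral_adjacent_intervals (a := fun k : ℕ => (k / n : ℝ))
      (fun k _ => hg.intervalIntegrable _ _)]
    simp [hn0.ne']
  have hterm : ∀ i ∈ Finset.range n, ‖g ((i + 1 : ℝ) / n) / n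
      - ∫ x in ((i : ℕ) / n : ℝ)..((i + 1 : ℕ) / n : ℝ), g x‖ ≤ ε / 2 * (1 / n) := by
    intro i hi
    have hlen : ((i + 1 : ℕ) / n : ℝ) - (i : ℕ) / n = 1 / n := by push_cast; ring
    have hc : g ((i + 1 : ℝ) / n) / n
        = ∫ x in ((i : ℕ) / n : ℝ)..((i + 1 : ℕ) / n : ℝ), g ((i + 1 : ℝ) / n) := by
      rw [intervalIntegral.integral_const, hlen]; simp; ring
    have hi1 : ((i : ℝ) + 1) / n ≤ 1 := by
      rw [div_le_one hn0]
      exact_mod_cast Finset.mem_range.1 hi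
    rw [hc, ← intervalIntegral.integral_sub (intervalIntegrable_const) (hg.intervalIntegrable _ _)]
    refine (intervalIntegral.norm_integral_le_of_norm_le_const (C := ε / 2) ?_).trans ?_
    · intro x hx
      rw [Set.uIoc_of_le (by gcongr; simp)] at hx
      have hx1 : (i : ℝ) / n < x := hx.1
      have hx2 : x ≤ ((i : ℝ) + 1) / n := by simpa using hx.2
      have hi0 : 0 ≤ (i : ℝ) / n := by positivity
      rw [← dist_eq_norm]
      refine H _ ⟨by positivity, hi1⟩ _ ⟨by linarith, by linarith⟩ ?_
      rw [Real.dist_eq, abs_of_nonneg (by linarith)]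
      have : ((i : ℝ) + 1) / n = i / n + 1 / n := by ring
      linarith
    · rw [hlen, abs_of_pos (by positivity)]
  rw [dist_eq_norm, hsplit, Finset.sum_div, ← Finset.sum_sub_distrib]
  refine (norm_sum_le_of_le _ hterm).trans_lt ?_
  rw [Finset.sum_const, Finset.card_range, nsmul_eq_mul]
  field_simp
  linarith

/-- `∫_0^x e^{θt} dt`. -/
def expInt (θ x : ℝ) : ℝ := ∫ t in (0 : ℝ)..x, Real.exp (θ * t)

/-- The average of `t ↦ e^{θt}` over `[0,x]`, extended continuously to `x = 0`. -/
def expAvg (θ x : ℝ) : ℝ := ∫ s in (0 : ℝ)..1, Real.exp (θ * (x * s))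

theorem continuous_exp_mul (θ : ℝ) : Continuous fun t : ℝ => Real.exp (θ * t) := by fun_prop

theorem continuous_expInt (θ : ℝ) : Continuous (expInt θ) :=
  intervalIntegral.continuous_primitive (fun _ _ => (continuous_exp_mul θ).intervalIntegrable _ _) 0

theorem hasDerivAt_expInt (θ x : ℝ) : HasDerivAt (expInt θ) (Real.exp (θ * x)) x :=
  ((continuous_exp_mul θ).integral_hasStrictDerivAt 0 x).hasDerivAt

theorem continuous_expAvg (θ : ℝ) : Continuous (expAvg θ) := by
  refine intervalIntegral.continuous_parametric_intervalIntegral_of_continuous'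
    (f := fun x s => Real.exp (θ * (x * s))) ?_ 0 1
  fun_prop

theorem expAvg_pos (θ x : ℝ) : 0 < expAvg θ x :=
  intervalIntegral.intervalIntegral_pos_of_pos
    ((by fun_prop : Continuous fun s => Real.exp (θ * (x * s))).intervalIntegrable _ _)
    (fun _ => Real.exp_pos _) one_pos

theorem expAvg_zero (θ : ℝ) : expAvg θ 0 = 1 := by simp [expAvg]

theorem continuous_log_expAvg (θ : ℝ) : Continuous fun x => Real.log (expAvg θ x) :=
  (continuous_expAvg θ).log fun x => (expAvg_pos θ x).ne'

theorem expInt_eq_mul_expAvg (θ x : ℝ) : expInt θ x = x * expAvg θ x := by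
  have := intervalIntegral.mul_integral_comp_mul_left (a := 0) (b := 1)
    (f := fun t => Real.exp (θ * t)) (c := x)
  rw [mul_zero, mul_one] at this
  exact this.symm

theorem expInt_pos (θ : ℝ) {x : ℝ} (hx : 0 < x) : 0 < expInt θ x := by
  rw [expInt_eq_mul_expAvg]; exact mul_pos hx (expAvg_pos θ x)

theorem expInt_zero (θ : ℝ) : expInt θ 0 = 0 := by simp [expInt]

theorem mul_expInt (θ x : ℝ) : θ * expInt θ x = Real.exp (θ * x) - 1 := by
  have h : ∀ t ∈ Set.uIcc 0 x, HasDerivAt (fun t => Real.exp (θ * t)) (θ * Real.exp (θ * t)) t := by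
    intro t _
    have := ((hasDerivAt_id t).const_mul θ).exp
    simpa [mul_comm] using this
  have := intervalIntegral.integral_eq_sub_of_hasDerivAt h
    ((continuous_const.mul (continuous_exp_mul θ)).intervalIntegrable _ _)
  rw [intervalIntegral.integral_const_mul] at this
  rw [mul_zero, Real.exp_zero] at this
  exact this

theorem expInt_add (θ a b : ℝ) : expInt θ (a + b) = expInt θ a + Real.exp (θ * a) * expInt θ b := by
  have hinteg : ∀ a b, IntervalIntegrable (fun t => Real.exp (θ * t)) volume a b :=
    fun a b => (continuous_exp_mul θ).intervalIntegrable _ _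
  have h := intervalIntegral.integral_comp_add_left (a := 0) (b := b)
    (fun t => Real.exp (θ * t)) a
  rw [expInt, expInt, expInt, ← intervalIntegral.integral_add_adjacent_intervals (hinteg 0 a) (hinteg a _),
    ← intervalIntegral.integral_const_mul]
  simp only [mul_add, Real.exp_add, add_zero] at h
  rw [h]

theorem geom_sum_mul_expInt (θ d : ℝ) (m : ℕ) :
    (∑ j ∈ Finset.range m, Real.exp (θ * d) ^ j) * expInt θ d = expInt θ (m * d) := by
  induction m with
  | zero => simp [expInt_zero]
  | succ m ih =>
    rw [Finset.sum_range_succ, add_mul, ih, Nat.cast_succ, add_mul, one_mul, expInt_add,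
      ← Real.exp_nat_mul, mul_left_comm]

theorem log_geom_sum (θ : ℝ) {d : ℝ} (hd : 0 < d) (i : ℕ) :
    Real.log (∑ j ∈ Finset.range (i + 1), Real.exp (θ * d) ^ j)
      = Real.log ((i + 1 : ℕ) : ℝ) + Real.log (expAvg θ ((i + 1) * d)) - Real.log (expAvg θ d) := by
  have h := geom_sum_mul_expInt θ d (i + 1)
  rw [expInt_eq_mul_expAvg, expInt_eq_mul_expAvg] at h
  have hi : (0 : ℝ) < ((i + 1 : ℕ) : ℝ) := by positivity
  have hd' := expAvg_pos θ d
  have hS : ∑ j ∈ Finset.range (i + 1), Real.exp (θ * d) ^ j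
      = ((i + 1 : ℕ) : ℝ) * expAvg θ (((i + 1 : ℕ) : ℝ) * d) / expAvg θ d := by
    rw [eq_div_iff hd'.ne']
    apply mul_left_cancel₀ hd.ne'
    linear_combination h
  rw [hS, Real.log_div (mul_pos hi (expAvg_pos _ _)).ne' hd'.ne',
    Real.log_mul hi.ne' (expAvg_pos _ _).ne']
  push_cast; rfl

theorem Cn_sub_log_factorial_div (θ : ℝ) {n : ℕ} (hn : n ≠ 0) :
    (Cn θ n - Real.log (Nat.factorial n)) / n
      = (∑ i ∈ Finset.range n, Real.log (expAvg θ ((i + 1 : ℝ) / n))) / n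
        - Real.log (expAvg θ (1 / n)) := by
  have hn0 : (0 : ℝ) < n := by exact_mod_cast Nat.pos_of_ne_zero hn
  have hC : Cn θ n = ∑ i ∈ Finset.range n,
      Real.log (∑ j ∈ Finset.range (i + 1), Real.exp (θ * (1 / n)) ^ j) := by
    rw [Cn, ← Real.log_prod, ← sum_pow_numInv]
    · congr 1
      refine Finset.sum_congr rfl fun π _ => ?_
      rw [← Real.exp_nat_mul]
      congr 1; ring
    · intro i _
      exact (Finset.sum_pos (fun _ _ => pow_pos (Real.exp_pos _) _) ⟨0, by simp⟩).ne'
  have hF : Real.log (Nat.factorial n) = ∑ i ∈ Finset.range n, Real.log ((i + 1 : ℕ) : ℝ) := by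
    rw [← Finset.prod_range_add_one_eq_factorial, Nat.cast_prod, Real.log_prod]
    intro i _
    positivity
  rw [hC, hF, ← Finset.sum_sub_distrib]
  simp_rw [log_geom_sum θ (one_div_pos.2 hn0), mul_one_div]
  have : ∀ i : ℕ, Real.log ((i + 1 : ℕ) : ℝ) + Real.log (expAvg θ ((i + 1) / n))
      - Real.log (expAvg θ (1 / n)) - Real.log ((i + 1 : ℕ) : ℝ)
      = Real.log (expAvg θ ((i + 1) / n)) - Real.log (expAvg θ (1 / n)) := fun i => by ring
  simp_rw [this]
  rw [Finset.sum_sub_distrib, Finset.sum_const, Finset.card_range, nsmul_eq_mul, sub_div,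
    mul_div_cancel_left₀ _ hn0.ne']

theorem tendsto_Cn (θ : ℝ) :
    Tendsto (fun n : ℕ => (Cn θ n - Real.log (Nat.factorial n)) / n) atTop
      (𝓝 (∫ x in (0 : ℝ)..1, Real.log (expAvg θ x))) := by
  have h1 := tendsto_riemann_sum (continuous_log_expAvg θ)
  have h2 : Tendsto (fun n : ℕ => Real.log (expAvg θ (1 / n))) atTop (𝓝 0) := by
    have := ((continuous_log_expAvg θ).tendsto 0).comp
      (tendsto_one_div_atTop_nhds_zero_nat (𝕜 := ℝ))
    rw [expAvg_zero, Real.log_one] at this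
    exact this
  have h3 := h1.sub h2
  rw [sub_zero] at h3
  refine h3.congr' ?_
  filter_upwards [eventually_ne_atTop 0] with n hn
  rw [Cn_sub_log_factorial_div θ hn]

instance : IsProbabilityMeasure unif01 := ⟨by simp [unif01]⟩

instance : NullSingletonClass unif01 := by unfold unif01; infer_instance

instance : IsProbabilityMeasure usq := by unfold usq; infer_instance

theorem ae_unif01_mem : ∀ᵐ x ∂unif01, x ∈ Set.Ioo (0 : ℝ) 1 := by
  rw [unif01, Measure.restrict_congr_set Ioo_ae_eq_Icc.symm]
  exact ae_restrict_mem measurableSet_Ioo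

theorem integral_unif01 (g : ℝ → ℝ) : ∫ x, g x ∂unif01 = ∫ x in (0 : ℝ)..1, g x := by
  rw [unif01, intervalIntegral.integral_of_le zero_le_one, integral_Icc_eq_integral_Ioc]

theorem integrable_log_unif01 : Integrable Real.log unif01 := by
  have := (intervalIntegral.intervalIntegrable_log' (a := 0) (b := 1))
  rw [intervalIntegrable_iff_integrableOn_Icc_of_le zero_le_one] at this
  exact this

theorem Continuous.integrable_unif01 {g : ℝ → ℝ} (hg : Continuous g) : Integrable g unif01 :=
  hg.continuousOn.integrableOn_Icc

/-- The density `y ↦ ∫_0^x ρ(x',y) dx'` of the second marginal of the part left of `x`. -/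
def leftDens (ρ : ℝ × ℝ → ℝ≥0∞) (p : ℝ × ℝ) : ℝ≥0∞ :=
  ∫⁻ x in Set.Iio p.1, ρ (x, p.2) ∂unif01

/-- The mass of the points forming an inversion with `p` on its upper left. -/
def upperLeft (μ : Measure (ℝ × ℝ)) (p : ℝ × ℝ) : ℝ :=
  (μ (Set.Iio p.1 ×ˢ Set.Ioi p.2)).toReal

theorem measurable_leftDens {ρ : ℝ × ℝ → ℝ≥0∞} (hρ : Measurable ρ) : Measurable (leftDens ρ) := by
  have h : leftDens ρ = fun p => ∫⁻ x, {q : (ℝ × ℝ) × ℝ | q.2 < q.1.1}.indicator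
      (fun q => ρ (q.2, q.1.2)) (p, x) ∂unif01 := by
    ext p
    rw [leftDens, ← lintegral_indicator measurableSet_Iio]
    rfl
  rw [h]
  refine Measurable.lintegral_prod_right' (f := {q : (ℝ × ℝ) × ℝ | q.2 < q.1.1}.indicator
      (fun q => ρ (q.2, q.1.2))) ?_
  refine Measurable.indicator (by fun_prop) (measurableSet_lt (by fun_prop) (by fun_prop))

theorem measurableSet_upperLeft :
    MeasurableSet {q : (ℝ × ℝ) × (ℝ × ℝ) | q.2.1 < q.1.1 ∧ q.1.2 < q.2.2} :=
  MeasurableSet.inter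
    (s₁ := {q : (ℝ × ℝ) × (ℝ × ℝ) | q.2.1 < q.1.1}) (s₂ := {q | q.1.2 < q.2.2})
    (measurableSet_lt (by fun_prop) (by fun_prop)) (measurableSet_lt (by fun_prop) (by fun_prop))

theorem measurable_upperLeft (μ : Measure (ℝ × ℝ)) [IsProbabilityMeasure μ] :
    Measurable (upperLeft μ) :=
  (measurable_measure_prodMk_left (ν := μ) measurableSet_upperLeft).ennreal_toReal

theorem upperLeft_nonneg (μ : Measure (ℝ × ℝ)) (p : ℝ × ℝ) : 0 ≤ upperLeft μ p :=
  ENNReal.toReal_nonneg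

theorem upperLeft_le_one (μ : Measure (ℝ × ℝ)) [IsProbabilityMeasure μ] (p : ℝ × ℝ) :
    upperLeft μ p ≤ 1 :=
  ENNReal.toReal_le_of_le_ofReal zero_le_one (by simpa using prob_le_one)

theorem integrable_upperLeft (μ : Measure (ℝ × ℝ)) [IsProbabilityMeasure μ] :
    Integrable (upperLeft μ) μ :=
  Integrable.of_bound (measurable_upperLeft μ).aestronglyMeasurable 1
    (Eventually.of_forall fun p => by
      rw [Real.norm_of_nonneg (upperLeft_nonneg μ p)]; exact upperLeft_le_one μ p)

theorem Hfun_eq (μ : Measure (ℝ × ℝ)) [IsProbabilityMeasure μ] :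
    Hfun μ = 2 * ∫ p, upperLeft μ p ∂μ := by
  set A := {q : (ℝ × ℝ) × (ℝ × ℝ) | q.2.1 < q.1.1 ∧ q.1.2 < q.2.2}
  have hA : MeasurableSet A := measurableSet_upperLeft
  have hset : {p : (ℝ × ℝ) × (ℝ × ℝ) | (p.1.1 - p.2.1) * (p.1.2 - p.2.2) < 0}
      = A ∪ Prod.swap ⁻¹' A := by
    ext p
    simp only [A, mul_neg_iff, sub_pos, sub_neg, Set.mem_ofPred_eq, Set.mem_union, Set.mem_preimage,
      Prod.fst_swap, Prod.snd_swap]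
  have hdisj : Disjoint A (Prod.swap ⁻¹' A) := by
    rw [Set.disjoint_left]
    rintro p ⟨h1, _⟩ ⟨h2, _⟩
    exact lt_asymm h1 h2
  have hswap : (μ.prod μ) (Prod.swap ⁻¹' A) = (μ.prod μ) A := by
    rw [← Measure.map_apply measurable_swap hA, Measure.prod_swap]
  have hinteg : ∫ p, upperLeft μ p ∂μ = ((μ.prod μ) A).toReal := by
    rw [Measure.prod_apply hA]
    exact integral_toReal (measurable_measure_prodMk_left hA).aemeasurable
      (Eventually.of_forall fun p => measure_lt_top _ _)
  rw [Hfun, hset, measure_union hdisj (measurable_swap hA), hswap, hinteg,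
    ENNReal.toReal_add (measure_ne_top _ _) (measure_ne_top _ _)]
  ring

theorem integral_log_le_of_lintegral_le_one {μ ν : Measure (ℝ × ℝ)} [IsProbabilityMeasure μ]
    {ρ q : ℝ × ℝ → ℝ≥0∞} (hρ : Measurable ρ) (hμ : μ = ν.withDensity ρ) (hρtop : ∀ᵐ p ∂ν, ρ p < ∞)
    (hq : Measurable q) (hq1 : ∫⁻ p, q p ∂ν ≤ 1) (hq0 : ∀ᵐ p ∂μ, q p ≠ 0)
    (hlogq : Integrable (fun p => Real.log (q p).toReal) μ)
    (hlogρ : Integrable (fun p => Real.log (ρ p).toReal) μ) :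
    ∫ p, Real.log (q p).toReal ∂μ ≤ ∫ p, Real.log (ρ p).toReal ∂μ := by
  have hac : μ ≪ ν := hμ ▸ withDensity_absolutelyContinuous ν ρ
  have hqtop : ∀ᵐ p ∂μ, q p < ∞ :=
    hac.ae_le (ae_lt_top hq (hq1.trans_lt ENNReal.one_lt_top).ne)
  have hρtop' : ∀ᵐ p ∂μ, ρ p < ∞ := hac.ae_le hρtop
  have hρ0 : ∀ᵐ p ∂μ, ρ p ≠ 0 := by
    rw [hμ, ae_withDensity_iff hρ]
    exact Eventually.of_forall fun p h => h
  have hqρ : Measurable fun p => q p / ρ p := hq.div hρ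
  have hlint : ∫⁻ p, q p / ρ p ∂μ ≤ 1 := by
    rw [hμ, lintegral_withDensity_eq_lintegral_mul _ hρ hqρ]
    refine (lintegral_mono fun p => ?_).trans hq1
    exact ENNReal.mul_div_le
  have hinteg : Integrable (fun p => (q p / ρ p).toReal) μ :=
    integrable_toReal_of_lintegral_ne_top hqρ.aemeasurable
      (hlint.trans_lt ENNReal.one_lt_top).ne
  have hint1 : ∫ p, (q p / ρ p).toReal ∂μ ≤ 1 := by
    rw [integral_toReal hqρ.aemeasurable
      (ae_lt_top hqρ (hlint.trans_lt ENNReal.one_lt_top).ne)]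
    exact ENNReal.toReal_le_of_le_ofReal zero_le_one (by simpa using hlint)
  have key : ∫ p, (Real.log (q p).toReal - Real.log (ρ p).toReal) ∂μ
      ≤ ∫ p, ((q p / ρ p).toReal - 1) ∂μ := by
    refine integral_mono_ae (hlogq.sub hlogρ) (hinteg.sub (integrable_const 1)) ?_
    filter_upwards [hqtop, hρtop', hρ0, hq0] with p h1 h2 h3 h4
    have hqp := ENNReal.toReal_pos h4 h1.ne
    have hρp := ENNReal.toReal_pos h3 h2.ne
    rw [← Real.log_div hqp.ne' hρp.ne', ENNReal.toReal_div]
    exact Real.log_le_sub_one_of_pos (div_pos hqp hρp)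
  rw [integral_sub hlogq hlogρ, integral_sub hinteg (integrable_const 1)] at key
  simp only [integral_const, probReal_univ, smul_eq_mul, one_mul] at key
  linarith

section Density

variable {ρ : ℝ × ℝ → ℝ≥0∞}

theorem withDensity_rect (hρ : Measurable ρ) {s t : Set ℝ} (hs : MeasurableSet s)
    (ht : MeasurableSet t) :
    usq.withDensity ρ (s ×ˢ t) = ∫⁻ y in t, ∫⁻ x in s, ρ (x, y) ∂unif01 ∂unif01 := by
  rw [withDensity_apply _ (hs.prod ht), usq, ← Measure.prod_restrict, lintegral_prod_symm' _ hρ]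

theorem map_snd_apply {μ : Measure (ℝ × ℝ)} {t : Set ℝ} (ht : MeasurableSet t) :
    μ.map Prod.snd t = μ (Set.univ ×ˢ t) := by
  rw [Measure.map_apply measurable_snd ht, Set.univ_prod]

theorem map_fst_apply {μ : Measure (ℝ × ℝ)} {t : Set ℝ} (ht : MeasurableSet t) :
    μ.map Prod.fst t = μ (t ×ˢ Set.univ) := by
  rw [Measure.map_apply measurable_fst ht, Set.prod_univ]

theorem ae_lintegral_fst_eq_one (hρ : Measurable ρ) (hμ : usq.withDensity ρ ∈ MM) :
    ∀ᵐ y ∂unif01, ∫⁻ x, ρ (x, y) ∂unif01 = 1 := by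
  refine ae_eq_of_forall_setLIntegral_eq_of_sigmaFinite (g := fun _ => 1)
    hρ.lintegral_prod_left' measurable_const fun t ht _ => ?_
  have h := withDensity_rect hρ MeasurableSet.univ ht
  rw [← map_snd_apply ht, hμ.2.2, Measure.restrict_univ] at h
  rw [← h]; simp

theorem unif01_Iio {x : ℝ} (h1 : x ≤ 1) : unif01 (Set.Iio x) = ENNReal.ofReal x := by
  rw [unif01, Measure.restrict_apply measurableSet_Iio]
  have : Set.Iio x ∩ Set.Icc 0 1 = Set.Ico 0 x := by
    ext t
    simp only [Set.mem_inter_iff, Set.mem_Iio, Set.mem_Icc, Set.mem_Ico]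
    constructor
    · rintro ⟨h, h', _⟩; exact ⟨h', h⟩
    · rintro ⟨h, h'⟩; exact ⟨h', h, h'.le.trans h1⟩
  rw [this, Real.volume_Ico, sub_zero]

theorem nullSingletonClass_withDensity_unif01 (g : ℝ → ℝ≥0∞) :
    NullSingletonClass (unif01.withDensity g) :=
  ⟨fun x => withDensity_absolutelyContinuous unif01 g (measure_singleton x)⟩

theorem leftDens_eq_withDensity (x y : ℝ) :
    leftDens ρ (x, y) = (unif01.withDensity fun x => ρ (x, y)) (Set.Iio x) := by
  rw [withDensity_apply _ measurableSet_Iio, leftDens]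

theorem map_leftDens_toReal (hρ : Measurable ρ) (hμ : usq.withDensity ρ ∈ MM) :
    (usq.withDensity ρ).map (fun p => (leftDens ρ p).toReal) = unif01 := by
  have hm := (measurable_leftDens hρ).ennreal_toReal
  refine Measure.ext_of_lintegral _ fun g hg => ?_
  have hgm : Measurable fun p => g (leftDens ρ p).toReal := hg.comp hm
  rw [lintegral_map hg hm, lintegral_withDensity_eq_lintegral_mul _ hρ hgm, usq,
    lintegral_prod_symm' _ (hρ.mul hgm)]
  have h : ∀ᵐ y ∂unif01, ∫⁻ x, ρ (x, y) * g (leftDens ρ (x, y)).toReal ∂unif01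
      = ∫⁻ t, g t ∂unif01 := by
    filter_upwards [ae_lintegral_fst_eq_one hρ hμ] with y hy
    set ν := unif01.withDensity fun x => ρ (x, y) with hν
    have huniv : ν Set.univ = 1 := by rw [hν, withDensity_apply _ MeasurableSet.univ]; simpa using hy
    have : IsFiniteMeasure ν := ⟨by rw [huniv]; exact ENNReal.one_lt_top⟩
    have : NullSingletonClass ν := nullSingletonClass_withDensity_unif01 _
    have h1 := lintegral_comp_measure_Iio ν hg
    have hρy : Measurable fun x => ρ (x, y) := by fun_prop
    have hgν : Measurable fun x => g (ν (Set.Iio x)).toReal :=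
      hg.comp (continuous_measure_Iio_toReal ν).measurable
    have h2 := lintegral_withDensity_eq_lintegral_mul unif01 hρy hgν
    rw [← hν, h1, huniv, ENNReal.toReal_one] at h2
    rw [unif01, h2, ← unif01]
    refine lintegral_congr fun x => ?_
    simp only [leftDens_eq_withDensity, hν, Pi.mul_apply]
  exact (lintegral_congr_ae h).trans (by simp)

theorem lintegral_leftDens_mul_exp (hρ : Measurable ρ) (hμ : usq.withDensity ρ ∈ MM) (θ : ℝ)
    {x : ℝ} (hx0 : 0 ≤ x) (hx1 : x ≤ 1) :
    ∫⁻ y, leftDens ρ (x, y)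
      * ENNReal.ofReal (Real.exp (θ * upperLeft (usq.withDensity ρ) (x, y))) ∂unif01
      = ENNReal.ofReal (expInt θ x) := by
  set ν := unif01.withDensity fun y => leftDens ρ (x, y) with hν
  have hνs : ∀ t, MeasurableSet t → ν t = usq.withDensity ρ (Set.Iio x ×ˢ t) := by
    intro t ht
    rw [withDensity_rect hρ measurableSet_Iio ht, hν, withDensity_apply _ ht]
    rfl
  have huniv : ν Set.univ = ENNReal.ofReal x := by
    rw [hνs _ MeasurableSet.univ, ← map_fst_apply measurableSet_Iio, hμ.2.1, unif01_Iio hx1]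
  have : IsFiniteMeasure ν := ⟨by rw [huniv]; exact ENNReal.ofReal_lt_top⟩
  have : NullSingletonClass ν := nullSingletonClass_withDensity_unif01 _
  have hg : Measurable fun t => ENNReal.ofReal (Real.exp (θ * t)) := by fun_prop
  have h1 := lintegral_comp_measure_Ioi ν hg
  have hup : ∀ y, (ν (Set.Ioi y)).toReal = upperLeft (usq.withDensity ρ) (x, y) := by
    intro y; rw [hνs _ measurableSet_Ioi]; rfl
  have hprob : IsProbabilityMeasure (usq.withDensity ρ) := hμ.1
  have hm : Measurable fun y => upperLeft (usq.withDensity ρ) (x, y) :=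
    (measurable_upperLeft _).comp (by fun_prop)
  have hl : Measurable fun y => leftDens ρ (x, y) := (measurable_leftDens hρ).comp (by fun_prop)
  have hgm : Measurable fun y =>
      ENNReal.ofReal (Real.exp (θ * upperLeft (usq.withDensity ρ) (x, y))) := hg.comp hm
  have h2 := lintegral_withDensity_eq_lintegral_mul unif01 hl hgm
  simp_rw [hup] at h1
  rw [← hν, h1, huniv, ENNReal.toReal_ofReal hx0] at h2
  refine Eq.trans h2.symm ?_
  rw [← ofReal_integral_eq_lintegral_ofReal (continuous_exp_mul θ).continuousOn.integrableOn_Icc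
    (Eventually.of_forall fun t => (Real.exp_pos _).le), integral_Icc_eq_integral_Ioc,
    ← intervalIntegral.integral_of_le hx0, expInt]

/-- The Gibbs density built from `ρ`: conditionally on the first coordinate `x`, it reweights the
second marginal of the part left of `x` by the exponential of the inversion count. -/
def gibbsDens (ρ : ℝ × ℝ → ℝ≥0∞) (θ : ℝ) (p : ℝ × ℝ) : ℝ≥0∞ :=
  leftDens ρ p * ENNReal.ofReal (Real.exp (θ * upperLeft (usq.withDensity ρ) p)) *
    ENNReal.ofReal (expInt θ p.1)⁻¹

theorem measurable_gibbsDens (hρ : Measurable ρ) (hμ : usq.withDensity ρ ∈ MM) (θ : ℝ) :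
    Measurable (gibbsDens ρ θ) := by
  have hprob : IsProbabilityMeasure (usq.withDensity ρ) := hμ.1
  have h1 := measurable_leftDens hρ
  have h2 := measurable_upperLeft (usq.withDensity ρ)
  have h3 := (continuous_expInt θ).measurable
  unfold gibbsDens
  fun_prop

theorem lintegral_gibbsDens (hρ : Measurable ρ) (hμ : usq.withDensity ρ ∈ MM) (θ : ℝ) :
    ∫⁻ p, gibbsDens ρ θ p ∂usq = 1 := by
  have hprob : IsProbabilityMeasure (usq.withDensity ρ) := hμ.1
  rw [usq, lintegral_prod _ (measurable_gibbsDens hρ hμ θ).aemeasurable]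
  have h : ∀ᵐ x ∂unif01, ∫⁻ y, gibbsDens ρ θ (x, y) ∂unif01 = 1 := by
    filter_upwards [ae_unif01_mem] with x hx
    have hm : Measurable fun y => leftDens ρ (x, y)
        * ENNReal.ofReal (Real.exp (θ * upperLeft (usq.withDensity ρ) (x, y))) := by
      have h1 := measurable_leftDens hρ
      have h2 := measurable_upperLeft (usq.withDensity ρ)
      fun_prop
    simp only [gibbsDens]
    rw [lintegral_mul_const _ hm, lintegral_leftDens_mul_exp hρ hμ θ hx.1.le hx.2.le,
      ← ENNReal.ofReal_mul (expInt_pos θ hx.1).le, mul_inv_cancel₀ (expInt_pos θ hx.1).ne',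
      ENNReal.ofReal_one]
  rw [lintegral_congr_ae h]; simp

theorem ae_leftDens_mem (hρ : Measurable ρ) (hμ : usq.withDensity ρ ∈ MM) :
    ∀ᵐ p ∂usq.withDensity ρ, leftDens ρ p ≠ 0 ∧ leftDens ρ p ≠ ∞ := by
  have h := ae_unif01_mem
  rw [← map_leftDens_toReal hρ hμ] at h
  filter_upwards [ae_of_ae_map (measurable_leftDens hρ).ennreal_toReal.aemeasurable h] with p hp
  exact (ENNReal.toReal_ne_zero.1 hp.1.ne')

theorem ae_fst_mem {μ : Measure (ℝ × ℝ)} (hμ : μ ∈ MM) : ∀ᵐ p ∂μ, p.1 ∈ Set.Ioo (0 : ℝ) 1 := by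
  have h := ae_unif01_mem
  rw [← hμ.2.1] at h
  exact ae_of_ae_map measurable_fst.aemeasurable h

theorem ae_gibbsDens_ne_zero (hρ : Measurable ρ) (hμ : usq.withDensity ρ ∈ MM) (θ : ℝ) :
    ∀ᵐ p ∂usq.withDensity ρ, gibbsDens ρ θ p ≠ 0 := by
  filter_upwards [ae_leftDens_mem hρ hμ, ae_fst_mem hμ] with p hp hp1
  have := expInt_pos θ hp1.1
  have := Real.exp_pos (θ * upperLeft (usq.withDensity ρ) p)
  simp only [gibbsDens, ne_eq, mul_eq_zero, not_or, ENNReal.ofReal_eq_zero, not_le]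
  exact ⟨⟨hp.1, this⟩, by positivity⟩

theorem integrable_comp_map {μ : Measure (ℝ × ℝ)} {φ : ℝ × ℝ → ℝ} (hφ : Measurable φ)
    (h : μ.map φ = unif01) {g : ℝ → ℝ} (hg : Integrable g unif01) :
    Integrable (fun p => g (φ p)) μ ∧ ∫ p, g (φ p) ∂μ = ∫ x, g x ∂unif01 := by
  rw [← h] at hg ⊢
  exact ⟨hg.comp_measurable hφ, (integral_map hφ.aemeasurable hg.1).symm⟩

theorem log_gibbsDens (hρ : Measurable ρ) (hμ : usq.withDensity ρ ∈ MM) (θ : ℝ) :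
    Integrable (fun p => Real.log (gibbsDens ρ θ p).toReal) (usq.withDensity ρ) ∧
    ∫ p, Real.log (gibbsDens ρ θ p).toReal ∂usq.withDensity ρ
      = θ / 2 * Hfun (usq.withDensity ρ) - ∫ x in (0 : ℝ)..1, Real.log (expAvg θ x) := by
  have hprob : IsProbabilityMeasure (usq.withDensity ρ) := hμ.1
  set μ := usq.withDensity ρ
  obtain ⟨i1, e1⟩ := integrable_comp_map (measurable_leftDens hρ).ennreal_toReal
    (map_leftDens_toReal hρ hμ) integrable_log_unif01
  obtain ⟨i2, e2⟩ := integrable_comp_map measurable_fst hμ.2.1 integrable_log_unif01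
  obtain ⟨i3, e3⟩ := integrable_comp_map measurable_fst hμ.2.1
    (continuous_log_expAvg θ).integrable_unif01
  have i4 := (integrable_upperLeft μ).const_mul θ
  have heq : (fun p => Real.log (gibbsDens ρ θ p).toReal) =ᵐ[μ] fun p =>
      Real.log (leftDens ρ p).toReal + θ * upperLeft μ p - Real.log p.1
        - Real.log (expAvg θ p.1) := by
    filter_upwards [ae_leftDens_mem hρ hμ, ae_fst_mem hμ] with p hp hp1
    have h1 := ENNReal.toReal_pos hp.1 hp.2
    have h2 := expAvg_pos θ p.1
    have h3 := expInt_pos θ hp1.1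
    rw [gibbsDens, ENNReal.toReal_mul, ENNReal.toReal_mul, ENNReal.toReal_ofReal (Real.exp_pos _).le,
      ENNReal.toReal_ofReal (inv_pos.2 h3).le,
      Real.log_mul (mul_pos h1 (Real.exp_pos _)).ne' (inv_pos.2 h3).ne',
      Real.log_mul h1.ne' (Real.exp_pos _).ne', Real.log_exp, Real.log_inv, expInt_eq_mul_expAvg,
      Real.log_mul hp1.1.ne' h2.ne']
    ring
  refine ⟨(((i1.add i4).sub i2).sub i3).congr heq.symm, ?_⟩
  have s1 := integral_sub ((i1.add i4).sub i2) i3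
  have s2 := integral_sub (i1.add i4) i2
  have s3 := integral_add i1 i4
  simp only [Pi.add_apply, Pi.sub_apply] at s1 s2 s3
  rw [integral_congr_ae heq, s1, s2, s3, integral_const_mul, Hfun_eq, ← integral_unif01, ← e3]
  linarith

end Density

theorem objM_le {θ : ℝ} {μ : Measure (ℝ × ℝ)} (hμ : μ ∈ MM) :
    objM θ μ ≤ ((∫ x in (0 : ℝ)..1, Real.log (expAvg θ x) : ℝ) : EReal) := by
  have hprob : IsProbabilityMeasure μ := hμ.1
  unfold objM
  by_cases h : μ ≪ usq ∧ Integrable (fun x => Real.log ((μ.rnDeriv usq x).toReal)) μ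
  · rw [KL, if_pos h]
    have hρ := Measure.measurable_rnDeriv μ usq
    have hd := Measure.withDensity_rnDeriv_eq μ usq h.1
    have hμ' : usq.withDensity (μ.rnDeriv usq) ∈ MM := hd.symm ▸ hμ
    obtain ⟨hi, he⟩ := log_gibbsDens hρ hμ' θ
    have h0 := ae_gibbsDens_ne_zero hρ hμ' θ
    rw [hd] at hi he h0
    have key := integral_log_le_of_lintegral_le_one hρ hd.symm (Measure.rnDeriv_lt_top μ usq)
      (measurable_gibbsDens hρ hμ' θ) (lintegral_gibbsDens hρ hμ' θ).le h0 hi h.2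
    rw [he] at key
    rw [EReal.coe_ennreal_ofReal, ← EReal.coe_sub, EReal.coe_le_coe_iff]
    have := le_max_left (∫ x, Real.log ((μ.rnDeriv usq x).toReal) ∂μ) 0
    linarith
  · rw [KL, if_neg h]
    simp

theorem unif01_restrict_Iio {x : ℝ} (hx1 : x ≤ 1) :
    unif01.restrict (Set.Iio x) = volume.restrict (Set.Ioc 0 x) := by
  rw [unif01, Measure.restrict_restrict measurableSet_Iio]
  have : Set.Iio x ∩ Set.Icc 0 1 = Set.Ico 0 x := by
    ext t
    simp only [Set.mem_inter_iff, Set.mem_Iio, Set.mem_Icc, Set.mem_Ico]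
    constructor
    · rintro ⟨h, h', _⟩; exact ⟨h', h⟩
    · rintro ⟨h, h'⟩; exact ⟨h', h, h'.le.trans hx1⟩
  rw [this, Measure.restrict_congr_set Ico_ae_eq_Ioc]

theorem unif01_restrict_Ioi {y : ℝ} (hy0 : 0 ≤ y) :
    unif01.restrict (Set.Ioi y) = volume.restrict (Set.Ioc y 1) := by
  rw [unif01, Measure.restrict_restrict measurableSet_Ioi]
  congr 1
  ext t
  simp only [Set.mem_inter_iff, Set.mem_Ioi, Set.mem_Icc, Set.mem_Ioc]
  constructor
  · rintro ⟨h, _, h'⟩; exact ⟨h, h'⟩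
  · rintro ⟨h, h'⟩; exact ⟨h, hy0.trans h.le, h'⟩

theorem lintegral_Ioc_eq_ofReal_sub {a b : ℝ} (hab : a ≤ b) {g F : ℝ → ℝ}
    (hF : ∀ t ∈ Set.Icc a b, HasDerivAt F (g t) t) (hg : ContinuousOn g (Set.Icc a b))
    (h0 : ∀ t ∈ Set.Icc a b, 0 ≤ g t) :
    ∫⁻ t in Set.Ioc a b, ENNReal.ofReal (g t) = ENNReal.ofReal (F b - F a) := by
  rw [← Set.uIcc_of_le hab] at hF hg
  have hi := hg.intervalIntegrable (μ := volume)
  rw [← intervalIntegral.integral_eq_sub_of_hasDerivAt hF hi,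
    intervalIntegral.integral_of_le hab, ofReal_integral_eq_lintegral_ofReal]
  · exact (intervalIntegrable_iff_integrableOn_Ioc_of_le hab).1 hi
  · filter_upwards [ae_restrict_mem measurableSet_Ioc] with t ht
    exact h0 t ⟨ht.1.le, ht.2⟩

/-- The denominator of the Frank copula. -/
def frankDen (θ x y : ℝ) : ℝ := 1 + θ * expInt θ x * expInt θ y / expInt θ 1

/-- The conditional distribution function of the Frank copula. -/
def frankCond (θ x y : ℝ) : ℝ :=
  expInt θ x * Real.exp (θ * y) / (expInt θ 1 * frankDen θ x y)

/-- The density of the Frank copula. -/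
def frankDens (θ x y : ℝ) : ℝ :=
  Real.exp (θ * x) * Real.exp (θ * y) / (expInt θ 1 * frankDen θ x y ^ 2)

theorem frankDen_pos (θ x : ℝ) {y : ℝ} (hy0 : 0 ≤ y) (hy1 : y ≤ 1) : 0 < frankDen θ x y := by
  have hc := expInt_pos θ one_pos
  have hy : 0 ≤ expInt θ y := by
    rw [expInt_eq_mul_expAvg]; exact mul_nonneg hy0 (expAvg_pos θ y).le
  have hyc : expInt θ y ≤ expInt θ 1 := by
    have h1 := expInt_add θ y (1 - y)
    rw [add_sub_cancel] at h1
    have h2 : 0 ≤ expInt θ (1 - y) := by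
      rw [expInt_eq_mul_expAvg]; exact mul_nonneg (by linarith) (expAvg_pos θ _).le
    have := mul_nonneg (Real.exp_pos (θ * y)).le h2
    linarith
  have h : frankDen θ x y = (expInt θ 1 - expInt θ y + Real.exp (θ * x) * expInt θ y) / expInt θ 1 := by
    rw [frankDen, mul_expInt]; field_simp; ring
  rw [h]
  refine div_pos ?_ hc
  have he := Real.exp_pos (θ * x)
  rcases hy.eq_or_lt with h0 | h0
  · rw [← h0]; simpa using hc
  · have := mul_pos he h0
    linarith

theorem frankDen_one_right (θ x : ℝ) : frankDen θ x 1 = Real.exp (θ * x) := by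
  have hc := (expInt_pos θ one_pos).ne'
  rw [frankDen, mul_div_assoc, div_self hc, mul_one, mul_expInt]; ring

theorem frankDen_comm (θ x y : ℝ) : frankDen θ x y = frankDen θ y x := by
  unfold frankDen; ring

theorem frankDens_comm (θ x y : ℝ) : frankDens θ x y = frankDens θ y x := by
  unfold frankDens; rw [frankDen_comm]; ring

theorem frankDens_nonneg (θ x y : ℝ) : 0 ≤ frankDens θ x y := by
  have hc := expInt_pos θ one_pos
  unfold frankDens; positivity

theorem hasDerivAt_frankCond (θ x : ℝ) {y : ℝ} (hy0 : 0 ≤ y) (hy1 : y ≤ 1) :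
    HasDerivAt (fun x => frankCond θ x y) (frankDens θ x y) x := by
  have hc := (expInt_pos θ one_pos).ne'
  have hD := (frankDen_pos θ x hy0 hy1).ne'
  have h1 := hasDerivAt_expInt θ x
  have h2 := h1.mul_const (Real.exp (θ * y))
  have h3 : HasDerivAt (fun x => expInt θ 1 * frankDen θ x y)
      (expInt θ 1 * (θ * Real.exp (θ * x) * expInt θ y / expInt θ 1)) x :=
    ((((h1.const_mul θ).mul_const _).div_const _).const_add 1).const_mul _
  refine (h2.div h3 (mul_ne_zero hc hD)).congr_deriv ?_
  rw [frankDens]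
  field_simp
  rw [frankDen]
  field_simp
  ring

theorem hasDerivAt_log_frankDen (θ x : ℝ) {y : ℝ} (hy0 : 0 ≤ y) (hy1 : y ≤ 1) :
    HasDerivAt (fun y => Real.log (frankDen θ x y)) (θ * frankCond θ x y) y := by
  have hc := (expInt_pos θ one_pos).ne'
  have hD := (frankDen_pos θ x hy0 hy1).ne'
  have h1 : HasDerivAt (fun y => frankDen θ x y)
      (θ * expInt θ x * Real.exp (θ * y) / expInt θ 1) y :=
    (((hasDerivAt_expInt θ y).const_mul _).div_const _).const_add 1
  refine (h1.log hD).congr_deriv ?_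
  rw [frankCond]
  field_simp

theorem continuous_frankDen (θ : ℝ) : Continuous fun p : ℝ × ℝ => frankDen θ p.1 p.2 := by
  have := continuous_expInt θ
  unfold frankDen; fun_prop

/-- The density of the Frank copula as an extended nonnegative function on the plane. -/
def frankRho (θ : ℝ) (p : ℝ × ℝ) : ℝ≥0∞ := ENNReal.ofReal (frankDens θ p.1 p.2)

theorem measurable_frankRho (θ : ℝ) : Measurable (frankRho θ) := by
  have := (continuous_frankDen θ).measurable
  unfold frankRho frankDens; fun_prop

theorem continuous_frankDen_left (θ y : ℝ) : Continuous fun x => frankDen θ x y :=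
  (continuous_frankDen θ).comp (by fun_prop : Continuous fun x => (x, y))

theorem continuous_frankDen_right (θ x : ℝ) : Continuous fun y => frankDen θ x y :=
  (continuous_frankDen θ).comp (by fun_prop : Continuous fun y => (x, y))

theorem lintegral_Ioc_frankRho (θ : ℝ) {x y : ℝ} (hx0 : 0 ≤ x) (hy0 : 0 ≤ y) (hy1 : y ≤ 1) :
    ∫⁻ t in Set.Ioc 0 x, frankRho θ (t, y) = ENNReal.ofReal (frankCond θ x y) := by
  have hc := (expInt_pos θ one_pos).ne'
  have h := lintegral_Ioc_eq_ofReal_sub hx0 (g := fun x => frankDens θ x y)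
    (fun t _ => hasDerivAt_frankCond θ t hy0 hy1)
    (by
      have := continuous_frankDen_left θ y
      refine Continuous.continuousOn (Continuous.div (by fun_prop) (by fun_prop) fun t => ?_)
      exact mul_ne_zero hc (pow_ne_zero _ (frankDen_pos θ t hy0 hy1).ne'))
    (fun t _ => frankDens_nonneg θ t y)
  have h0 : frankCond θ 0 y = 0 := by simp [frankCond, expInt_zero]
  rw [h0, sub_zero] at h
  exact h

theorem leftDens_frankRho (θ : ℝ) {x y : ℝ} (hx0 : 0 ≤ x) (hx1 : x ≤ 1) (hy0 : 0 ≤ y)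
    (hy1 : y ≤ 1) : leftDens (frankRho θ) (x, y) = ENNReal.ofReal (frankCond θ x y) := by
  rw [leftDens, unif01_restrict_Iio hx1, lintegral_Ioc_frankRho θ hx0 hy0 hy1]

theorem lintegral_frankRho_fst (θ : ℝ) {y : ℝ} (hy0 : 0 ≤ y) (hy1 : y ≤ 1) :
    ∫⁻ x, frankRho θ (x, y) ∂unif01 = 1 := by
  have hc := (expInt_pos θ one_pos).ne'
  rw [unif01, Measure.restrict_congr_set Ioc_ae_eq_Icc.symm,
    lintegral_Ioc_frankRho θ zero_le_one hy0 hy1, frankCond, frankDen_comm, frankDen_one_right,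
    div_self (mul_ne_zero hc (Real.exp_pos _).ne'), ENNReal.ofReal_one]

theorem frank_mem_MM (θ : ℝ) : usq.withDensity (frankRho θ) ∈ MM := by
  have hρ := measurable_frankRho θ
  have h1 : ∀ᵐ y ∂unif01, ∫⁻ x, frankRho θ (x, y) ∂unif01 = 1 := by
    filter_upwards [ae_unif01_mem] with y hy
    exact lintegral_frankRho_fst θ hy.1.le hy.2.le
  have hsnd : (usq.withDensity (frankRho θ)).map Prod.snd = unif01 := by
    ext t ht
    rw [map_snd_apply ht, withDensity_rect hρ MeasurableSet.univ ht, Measure.restrict_univ,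
      lintegral_congr_ae (ae_restrict_of_ae h1)]
    simp
  have hfst : (usq.withDensity (frankRho θ)).map Prod.fst = unif01 := by
    ext t ht
    have hsymm : ∀ x y, frankRho θ (x, y) = frankRho θ (y, x) := fun x y => by
      simp only [frankRho, frankDens_comm θ x y]
    rw [map_fst_apply ht, withDensity_apply _ (ht.prod MeasurableSet.univ), usq,
      ← Measure.prod_restrict, lintegral_prod _ hρ.aemeasurable, Measure.restrict_univ]
    have h2 : ∀ᵐ x ∂unif01, ∫⁻ y, frankRho θ (x, y) ∂unif01 = 1 := by
      filter_upwards [h1] with x hx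
      rw [← hx]; exact lintegral_congr fun y => hsymm x y
    rw [lintegral_congr_ae (ae_restrict_of_ae h2)]
    simp
  refine ⟨⟨?_⟩, hfst, hsnd⟩
  rw [← Set.univ_prod_univ, ← map_fst_apply MeasurableSet.univ, hfst, measure_univ]

theorem mul_upperLeft_frank (θ : ℝ) {x y : ℝ} (hx0 : 0 ≤ x) (hx1 : x ≤ 1) (hy0 : 0 ≤ y)
    (hy1 : y ≤ 1) :
    θ * upperLeft (usq.withDensity (frankRho θ)) (x, y) = θ * x - Real.log (frankDen θ x y) := by
  have hc := expInt_pos θ one_pos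
  have hcont : ContinuousOn (fun y => frankCond θ x y) (Set.Icc y 1) := by
    have h := continuous_frankDen_right θ x
    refine ContinuousOn.div (by fun_prop) (by fun_prop) fun t ht => ?_
    exact mul_ne_zero hc.ne' (frankDen_pos θ x (hy0.trans ht.1) ht.2).ne'
  have hnn : ∀ t ∈ Set.Icc y 1, 0 ≤ frankCond θ x t := by
    intro t ht
    have h1 := frankDen_pos θ x (hy0.trans ht.1) ht.2
    have h2 : 0 ≤ expInt θ x := by
      rw [expInt_eq_mul_expAvg]; exact mul_nonneg hx0 (expAvg_pos θ x).le
    unfold frankCond; positivity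
  have hup : upperLeft (usq.withDensity (frankRho θ)) (x, y) = ∫ t in y..1, frankCond θ x t := by
    have h1 : usq.withDensity (frankRho θ) (Set.Iio x ×ˢ Set.Ioi y)
        = ∫⁻ t in Set.Ioc y 1, ENNReal.ofReal (frankCond θ x t) := by
      rw [withDensity_rect (measurable_frankRho θ) measurableSet_Iio measurableSet_Ioi,
        unif01_restrict_Ioi hy0, unif01_restrict_Iio hx1]
      refine setLIntegral_congr_fun measurableSet_Ioc fun t ht => ?_
      exact lintegral_Ioc_frankRho θ hx0 (hy0.trans ht.1.le) ht.2
    rw [upperLeft, h1, intervalIntegral.integral_of_le hy1,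
      integral_eq_lintegral_of_nonneg_ae]
    · filter_upwards [ae_restrict_mem measurableSet_Ioc] with t ht
      exact hnn t ⟨ht.1.le, ht.2⟩
    · exact (hcont.mono Set.Ioc_subset_Icc_self).aestronglyMeasurable measurableSet_Ioc
  rw [hup, ← intervalIntegral.integral_const_mul]
  rw [intervalIntegral.integral_eq_sub_of_hasDerivAt (f := fun y => Real.log (frankDen θ x y)),
    frankDen_one_right, Real.log_exp]
  · intro t ht
    rw [Set.uIcc_of_le hy1] at ht
    exact hasDerivAt_log_frankDen θ x (hy0.trans ht.1) ht.2
  · rw [← Set.uIcc_of_le hy1] at hcont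
    exact (continuousOn_const.mul hcont).intervalIntegrable

theorem gibbsDens_frankRho (θ : ℝ) {x y : ℝ} (hx0 : 0 < x) (hx1 : x ≤ 1) (hy0 : 0 ≤ y)
    (hy1 : y ≤ 1) : gibbsDens (frankRho θ) θ (x, y) = frankRho θ (x, y) := by
  have hc := expInt_pos θ one_pos
  have hx := expInt_pos θ hx0
  have hD := frankDen_pos θ x hy0 hy1
  have hK : 0 ≤ frankCond θ x y := by unfold frankCond; positivity
  rw [gibbsDens, leftDens_frankRho θ hx0.le hx1 hy0 hy1, mul_upperLeft_frank θ hx0.le hx1 hy0 hy1,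
    ← ENNReal.ofReal_mul hK, ← ENNReal.ofReal_mul (by positivity), frankRho, Real.exp_sub,
    Real.exp_log hD, frankCond, frankDens]
  congr 1
  field_simp

theorem ae_snd_mem {μ : Measure (ℝ × ℝ)} (hμ : μ ∈ MM) : ∀ᵐ p ∂μ, p.2 ∈ Set.Ioo (0 : ℝ) 1 := by
  have h := ae_unif01_mem
  rw [← hμ.2.2] at h
  exact ae_of_ae_map measurable_snd.aemeasurable h

theorem objM_frank (θ : ℝ) :
    objM θ (usq.withDensity (frankRho θ))
      = ((∫ x in (0 : ℝ)..1, Real.log (expAvg θ x) : ℝ) : EReal) := by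
  have hρ := measurable_frankRho θ
  have hMM := frank_mem_MM θ
  obtain ⟨hi, he⟩ := log_gibbsDens hρ hMM θ
  set μ := usq.withDensity (frankRho θ) with hμ
  have hprob : IsProbabilityMeasure μ := hMM.1
  have hac : μ ≪ usq := withDensity_absolutelyContinuous _ _
  have hgibbs : (fun p => Real.log (gibbsDens (frankRho θ) θ p).toReal)
      =ᵐ[μ] fun p => Real.log (frankRho θ p).toReal := by
    filter_upwards [ae_fst_mem hMM, ae_snd_mem hMM] with p h1 h2
    rw [gibbsDens_frankRho θ h1.1 h1.2.le h2.1.le h2.2.le]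
  have hrn : (fun p => Real.log (frankRho θ p).toReal)
      =ᵐ[μ] fun p => Real.log (μ.rnDeriv usq p).toReal := by
    filter_upwards [hac.ae_le (Measure.rnDeriv_withDensity usq hρ)] with p hp
    rw [hp]
  have hi' := hi.congr hgibbs
  have he' := (integral_congr_ae hgibbs).symm.trans he
  have hnonneg : 0 ≤ ∫ p, Real.log (frankRho θ p).toReal ∂μ := by
    have := integral_log_le_of_lintegral_le_one (q := fun _ => 1) hρ hμ
      (Eventually.of_forall fun p => ENNReal.ofReal_lt_top) measurable_const (by simp)
      (by simp) (by simp) hi'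
    simpa using this
  rw [objM, KL, if_pos ⟨hac, hi'.congr hrn⟩, ← integral_congr_ae hrn, EReal.coe_ennreal_ofReal,
    max_eq_left hnonneg, ← EReal.coe_sub, he']
  congr 1
  ring

/-- For every `θ`, `(C_n(θ) − log n!)/n` converges to
`C(θ) = sup_{μ ∈ 𝓜} {(θ/2)(μ×μ)(h) − D(μ‖u)}`. -/
theorem mallows_log_partition_limit (θ : ℝ) :
    ∃ C : ℝ, (⨆ μ ∈ MM, objM θ μ) = (C : EReal) ∧
      Tendsto (fun n : ℕ => (Cn θ n - Real.log (Nat.factorial n)) / n) atTop (𝓝 C) := by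
  refine ⟨∫ x in (0 : ℝ)..1, Real.log (expAvg θ x), le_antisymm ?_ ?_, tendsto_Cn θ⟩
  · exact iSup₂_le fun μ hμ => objM_le hμ
  · rw [← objM_frank θ]
    exact le_iSup₂ (f := fun μ (_ : μ ∈ MM) => objM θ μ) _ (frank_mem_MM θ)
end
end
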